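/- Assume conditions (A1)–(A4). Then for each p ∈ ℕ ∪ {∞} (with the convention a ∧ ∞ = a), (1/n) Σ_{k=1}^n (Z_k(g)² ∧ p) converges, ℙ_μ-almost surely as n → ∞, to E_{μ_*}[Z'_1(g)² ∧ p], the corresponding expectation for the stationary process Φ' started from μ_*. -/

import Mathlib

open MeasureTheory Filter Set
open scoped ENNReal Topology NNReal

noncomputable section

variable {X : Type*} [MetricSpace X] [CompleteSpace X] [SecondCountableTopology X]
  [MeasurableSpace X] [BorelSpace X]

/-- Action of a transition kernel family on measures: `ν ↦ ν P_t`. -/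
def measAct (P : ℝ → X → Measure X) (t : ℝ) (ν : Measure X) : Measure X :=
  ν.bind (P t)

/-- Dual action of the semigroup on functions: `f ↦ P_t f`. -/
def funAct (P : ℝ → X → Measure X) (t : ℝ) (f : X → ℝ) (x : X) : ℝ :=
  ∫ y, f y ∂(P t x)

/-- A Borel (probability) measure has a finite first moment. -/
def FiniteFirstMoment (ν : Measure X) : Prop :=
  ∀ x₀ : X, Integrable (fun x => dist x₀ x) ν

/-- The Wasserstein (Kantorovich–Rubinstein) distance `d_W`. -/
def wassDist (μ ν : Measure X) : ℝ :=
  sSup {r | ∃ f : X → ℝ, LipschitzWith 1 f ∧ r = |(∫ x, f x ∂μ) - ∫ x, f x ∂ν|}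

/-- A Markov semigroup `{P_t}_{t ≥ 0}` of probability kernels on `X`. -/
structure IsMarkovSemigroup (P : ℝ → X → Measure X) : Prop where
  prob : ∀ t, 0 ≤ t → ∀ x, IsProbabilityMeasure (P t x)
  jointMeas : ∀ A : Set X, MeasurableSet A → Measurable fun p : ℝ × X => P p.1 p.2 A
  init : ∀ x, P 0 x = Measure.dirac x
  chapman : ∀ s t, 0 ≤ s → 0 ≤ t → ∀ x, P (s + t) x = (P s x).bind (P t)

/-- Condition (A1): stochastic continuity of the semigroup. -/
def CondA1 (P : ℝ → X → Measure X) : Prop :=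
  ∀ f : X → ℝ, Continuous f → (∃ C, ∀ x, |f x| ≤ C) →
    ∀ x : X, Tendsto (fun t => funAct P t f x) (𝓝[>] (0 : ℝ)) (𝓝 (f x))

/-- Condition (A2): the Feller property. -/
def CondA2 (P : ℝ → X → Measure X) : Prop :=
  ∀ f : X → ℝ, Continuous f → (∃ C, ∀ x, |f x| ≤ C) → ∀ t, 0 ≤ t →
    Continuous (funAct P t f) ∧ ∃ C, ∀ x, |funAct P t f x| ≤ C

/-- Condition (A3): preservation of finite first moments and exponential
contractivity in the Wasserstein distance, with rate `γ`. -/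
def CondA3 (P : ℝ → X → Measure X) (γ : ℝ) : Prop :=
  (∀ ν : Measure X, IsProbabilityMeasure ν → FiniteFirstMoment ν →
    ∀ t, 0 < t → FiniteFirstMoment (measAct P t ν)) ∧
  0 < γ ∧
  ∀ t, 0 ≤ t → ∀ x y : X,
    wassDist (P t x) (P t y) ≤ Real.exp (-γ * t) * dist x y

/-- Condition (A4): a uniform-in-time moment bound of order `ζ > 2` for the initial
distribution `μ`, along the semigroup. -/
def CondA4 (P : ℝ → X → Measure X) (μ : Measure X) (x₀ : X) (ζ : ℝ) : Prop :=
  2 < ζ ∧ ∃ M : ℝ, ∀ t, 0 ≤ t →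
    (∫⁻ x, ENNReal.ofReal (dist x₀ x ^ ζ) ∂(measAct P t μ)) ≤ ENNReal.ofReal M

variable {Ω : Type*} [MeasurableSpace Ω]

/-- The natural filtration of the process `Φ`. -/
def natFiltration (Φ : ℝ → Ω → X) (s : ℝ) : MeasurableSpace Ω :=
  ⨆ u ∈ Set.Icc (0 : ℝ) s, MeasurableSpace.comap (Φ u) inferInstance

/-- A (progressively measurable) time-homogeneous Markov process with state space `X`,
transition semigroup `P` and initial distribution `μ`, realized on `(Ω, ℙ)`. -/
structure IsMarkovProcess (P : ℝ → X → Measure X) (Φ : ℝ → Ω → X)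
    (ℙ : Measure Ω) (μ : Measure X) : Prop where
  jointMeas : Measurable fun p : ℝ × Ω => Φ p.1 p.2
  init : ℙ.map (Φ 0) = μ
  law : ∀ t, 0 ≤ t → ℙ.map (Φ t) = measAct P t μ
  markov : ∀ f : X → ℝ, Measurable f → (∃ C, ∀ x, |f x| ≤ C) →
    ∀ s t : ℝ, 0 ≤ s → 0 ≤ t →
      (fun ω => funAct P t f (Φ s ω)) =ᵐ[ℙ]
        ℙ[(fun ω => f (Φ (s + t) ω)) | natFiltration Φ s]

/-- A Markov process together with a measurable family of laws `{ℙ_x}_{x ∈ X}`,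
with `ℙ_x(Φ_0 = x) = 1`. -/
structure IsMarkovFamily (P : ℝ → X → Measure X) (Φ : ℝ → Ω → X)
    (ℙ : X → Measure Ω) : Prop where
  prob : ∀ x, IsProbabilityMeasure (ℙ x)
  jointMeas : Measurable fun p : ℝ × Ω => Φ p.1 p.2
  measFam : ∀ s : Set Ω, MeasurableSet s → Measurable fun x => ℙ x s
  start : ∀ x, (ℙ x) {ω | Φ 0 ω = x} = 1
  law : ∀ x, ∀ t, 0 ≤ t → (ℙ x).map (Φ t) = P t x
  markov : ∀ x : X, ∀ f : X → ℝ, Measurable f → (∃ C, ∀ z, |f z| ≤ C) →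
    ∀ s t : ℝ, 0 ≤ s → 0 ≤ t →
      (fun ω => funAct P t f (Φ s ω)) =ᵐ[ℙ x]
        (ℙ x)[(fun ω => f (Φ (s + t) ω)) | natFiltration Φ s]

/-- The corrector function `χ_g(x) = ∫_0^∞ (P_t g)(x) dt`. -/
def corrector (P : ℝ → X → Measure X) (g : X → ℝ) (x : X) : ℝ :=
  ∫ t in Set.Ioi (0 : ℝ), funAct P t g x

/-- The additive functional `I_t(g) = ∫_0^t g(Φ_s) ds`. -/
def addFun (g : X → ℝ) (Φ : ℝ → Ω → X) (t : ℝ) (ω : Ω) : ℝ :=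
  ∫ s in (0 : ℝ)..t, g (Φ s ω)

/-- The martingale part `M_t(g) = χ_g(Φ_t) - χ_g(Φ_0) + I_t(g)`. -/
def mart (P : ℝ → X → Measure X) (g : X → ℝ) (Φ : ℝ → Ω → X) (t : ℝ) (ω : Ω) : ℝ :=
  corrector P g (Φ t ω) - corrector P g (Φ 0 ω) + addFun g Φ t ω

/-- The martingale increments `Z_n(g) = M_n(g) - M_{n-1}(g)`. -/
def incr (P : ℝ → X → Measure X) (g : X → ℝ) (Φ : ℝ → Ω → X) (n : ℕ) (ω : Ω) : ℝ :=
  mart P g Φ (n : ℝ) ω - mart P g Φ ((n : ℝ) - 1) ω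

/-- Truncation `a ∧ p` for `p ∈ ℕ ∪ {∞}`, with the convention `a ∧ ∞ = a`. -/
def truncMin (a : ℝ) (p : ℕ∞) : ℝ :=
  if p = ⊤ then a else min a (p.toNat : ℝ)

set_option linter.unusedSectionVars false
set_option linter.style.haveILetI false

/-! ## Basic facts on the semigroup -/

lemma aux_meas_P {P : ℝ → X → Measure X} (hP : IsMarkovSemigroup P) (t : ℝ) :
    Measurable (P t) := by
  refine Measure.measurable_of_measurable_coe _ fun s hs => ?_
  exact (hP.jointMeas s hs).comp (measurable_const.prodMk measurable_id)

/-- the kernel at time `t` -/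
def aux_ker {P : ℝ → X → Measure X} (hP : IsMarkovSemigroup P) (t : ℝ) :
    ProbabilityTheory.Kernel X X := ⟨P t, aux_meas_P hP t⟩

lemma aux_ker_apply {P : ℝ → X → Measure X} (hP : IsMarkovSemigroup P) (t : ℝ) (x : X) :
    aux_ker hP t x = P t x := rfl

lemma aux_ker_markov {P : ℝ → X → Measure X} (hP : IsMarkovSemigroup P) {t : ℝ} (ht : 0 ≤ t) :
    ProbabilityTheory.IsMarkovKernel (aux_ker hP t) :=
  ⟨fun x => hP.prob t ht x⟩

/-- the jointly measurable kernel -/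
def aux_kerJ {P : ℝ → X → Measure X} (hP : IsMarkovSemigroup P) :
    ProbabilityTheory.Kernel (ℝ × X) X :=
  ⟨fun p => P p.1 p.2, Measure.measurable_of_measurable_coe _ fun s hs => hP.jointMeas s hs⟩

lemma aux_meas_funAct {P : ℝ → X → Measure X} (hP : IsMarkovSemigroup P) {f : X → ℝ}
    (hf : Measurable f) : Measurable (fun p : ℝ × X => funAct P p.1 f p.2) :=
  (StronglyMeasurable.integral_kernel (κ := aux_kerJ hP) hf.stronglyMeasurable).measurable

lemma aux_meas_funAct' {P : ℝ → X → Measure X} (hP : IsMarkovSemigroup P) {f : X → ℝ}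
    (hf : Measurable f) (t : ℝ) : Measurable (funAct P t f) :=
  (aux_meas_funAct hP hf).comp (measurable_const.prodMk measurable_id)

lemma aux_bdd_integrable {E : Type*} [MeasurableSpace E] {ν : Measure E} [IsFiniteMeasure ν]
    {f : E → ℝ} (hf : Measurable f) {C : ℝ} (hC : ∀ x, |f x| ≤ C) : Integrable f ν :=
  Integrable.of_bound hf.aestronglyMeasurable C (Eventually.of_forall hC)

lemma aux_bdd_integral {E : Type*} [MeasurableSpace E] {ν : Measure E} [IsProbabilityMeasure ν]
    {f : E → ℝ} {C : ℝ} (hC : ∀ x, |f x| ≤ C) : |∫ x, f x ∂ν| ≤ C := by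
  have := norm_integral_le_of_norm_le_const (μ := ν) (f := f) (C := C) (Eventually.of_forall hC)
  simpa using this

lemma aux_prob_measAct {P : ℝ → X → Measure X} (hP : IsMarkovSemigroup P) {ν : Measure X}
    [IsProbabilityMeasure ν] {t : ℝ} (ht : 0 ≤ t) : IsProbabilityMeasure (measAct P t ν) := by
  haveI := aux_ker_markov hP ht
  have : measAct P t ν = ν.bind (aux_ker hP t) := rfl
  rw [this]; infer_instance

lemma aux_integral_measAct {P : ℝ → X → Measure X} (hP : IsMarkovSemigroup P) {ν : Measure X}
    [IsProbabilityMeasure ν] {t : ℝ} (ht : 0 ≤ t) {f : X → ℝ} (hf : Measurable f) {C : ℝ}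
    (hC : ∀ x, |f x| ≤ C) : ∫ x, f x ∂(measAct P t ν) = ∫ x, funAct P t f x ∂ν := by
  haveI := aux_prob_measAct hP (ν := ν) ht
  have h := ProbabilityTheory.Kernel.integral_comp (κ := ProbabilityTheory.Kernel.const Unit ν)
    (η := aux_ker hP t) (a := ()) (f := f) (by
      rw [ProbabilityTheory.Kernel.comp_apply]
      exact aux_bdd_integrable (ν := measAct P t ν) hf hC)
  rw [ProbabilityTheory.Kernel.comp_apply] at h
  exact h

lemma aux_firstMoment {P : ℝ → X → Measure X} (hP : IsMarkovSemigroup P) {γ : ℝ}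
    (hA3 : CondA3 P γ) {t : ℝ} (ht : 0 ≤ t) (x : X) : FiniteFirstMoment (P t x) := by
  have h0 : FiniteFirstMoment (Measure.dirac x) := fun x₀ =>
    integrable_dirac' (by fun_prop) (by simp)
  rcases ht.eq_or_lt with rfl | ht
  · rw [hP.init]; exact h0
  · have := hA3.1 (Measure.dirac x) inferInstance h0 t ht
    rwa [measAct, Measure.dirac_bind (aux_meas_P hP t)] at this

lemma aux_lip_cont {f : X → ℝ} {L : ℝ} (hL : ∀ x y, |f x - f y| ≤ L * dist x y) :
    Continuous f := by
  have : LipschitzWith (L.toNNReal) f := LipschitzWith.of_dist_le_mul fun x y => by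
    rw [Real.dist_eq]
    exact (hL x y).trans (mul_le_mul_of_nonneg_right (Real.le_coe_toNNReal L) dist_nonneg)
  exact this.continuous

lemma aux_lip_integrable {ν : Measure X} [IsFiniteMeasure ν] {x₀ : X}
    (hν : Integrable (fun x => dist x₀ x) ν) {f : X → ℝ} {L : ℝ}
    (hL : ∀ x y, |f x - f y| ≤ L * dist x y) : Integrable f ν := by
  have hc := aux_lip_cont hL
  refine Integrable.mono' ((hν.const_mul L).add (integrable_const |f x₀|))
    hc.measurable.aestronglyMeasurable (Eventually.of_forall fun x => ?_)
  have := hL x₀ x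
  have h2 := abs_sub_abs_le_abs_sub (f x) (f x₀)
  rw [abs_sub_comm] at h2
  simp only [Real.norm_eq_abs, Pi.add_apply]
  linarith

lemma aux_wass_bdd {ν₁ ν₂ : Measure X} [IsProbabilityMeasure ν₁] [IsProbabilityMeasure ν₂]
    (h1 : FiniteFirstMoment ν₁) (h2 : FiniteFirstMoment ν₂) (x₀ : X) :
    BddAbove {r | ∃ f : X → ℝ, LipschitzWith 1 f ∧ r = |(∫ x, f x ∂ν₁) - ∫ x, f x ∂ν₂|} := by
  refine ⟨(∫ x, dist x₀ x ∂ν₁) + ∫ x, dist x₀ x ∂ν₂, ?_⟩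
  rintro r ⟨f, hf, rfl⟩
  have hL : ∀ x y, |f x - f y| ≤ 1 * dist x y := fun x y => by
    have := hf.dist_le_mul x y
    rwa [Real.dist_eq] at this
  have key : ∀ ν : Measure X, IsProbabilityMeasure ν → FiniteFirstMoment ν →
      |(∫ x, f x ∂ν) - f x₀| ≤ ∫ x, dist x₀ x ∂ν := by
    intro ν _ hν
    have hi : Integrable f ν := aux_lip_integrable (hν x₀) hL
    have : (∫ x, f x ∂ν) - f x₀ = ∫ x, (f x - f x₀) ∂ν := by
      rw [integral_sub hi (integrable_const _)]; simp
    rw [this]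
    refine (abs_integral_le_integral_abs).trans ?_
    refine integral_mono (hi.sub (integrable_const _)).abs (hν x₀) fun x => ?_
    have := hL x x₀
    simp only
    rw [dist_comm x₀ x]; linarith
  have a := key ν₁ inferInstance h1
  have b := key ν₂ inferInstance h2
  rw [abs_le] at *
  constructor <;> linarith [a.1, a.2, b.1, b.2]

lemma aux_contract {P : ℝ → X → Measure X} (hP : IsMarkovSemigroup P) {γ : ℝ}
    (hA3 : CondA3 P γ) {t : ℝ} (ht : 0 ≤ t) {f : X → ℝ} {L : ℝ} (hL0 : 0 ≤ L)
    (hL : ∀ x y, |f x - f y| ≤ L * dist x y) (x y : X) :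
    |funAct P t f x - funAct P t f y| ≤ L * Real.exp (-γ * t) * dist x y := by
  haveI := hP.prob t ht x
  haveI := hP.prob t ht y
  rcases hL0.eq_or_lt with rfl | hLp
  · have : ∀ z, f z = f x := fun z => by
      have := hL z x
      rw [zero_mul] at this
      exact sub_eq_zero.1 (abs_nonpos_iff.1 this)
    simp [funAct, this]
  · have hlip : LipschitzWith 1 (fun z => L⁻¹ * f z) := LipschitzWith.of_dist_le_mul fun a b => by
      rw [Real.dist_eq, ← mul_sub, abs_mul, abs_of_pos (inv_pos.2 hLp)]
      have := mul_le_mul_of_nonneg_left (hL a b) (inv_pos.2 hLp).le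
      rw [← mul_assoc, inv_mul_cancel₀ hLp.ne'] at this
      simpa using this
    have h1 : |(∫ z, L⁻¹ * f z ∂(P t x)) - ∫ z, L⁻¹ * f z ∂(P t y)| ≤ wassDist (P t x) (P t y) :=
      le_csSup (aux_wass_bdd (aux_firstMoment hP hA3 ht x) (aux_firstMoment hP hA3 ht y) x)
        ⟨_, hlip, rfl⟩
    have h2 := h1.trans (hA3.2.2 t ht x y)
    rw [integral_const_mul, integral_const_mul, ← mul_sub, abs_mul, abs_of_pos (inv_pos.2 hLp),
      inv_mul_le_iff₀ hLp, ← mul_assoc] at h2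
    exact h2

lemma aux_funAct_bdd {P : ℝ → X → Measure X} (hP : IsMarkovSemigroup P) {t : ℝ} (ht : 0 ≤ t)
    {f : X → ℝ} {C : ℝ} (hC : ∀ x, |f x| ≤ C) (x : X) : |funAct P t f x| ≤ C := by
  haveI := hP.prob t ht x
  exact aux_bdd_integral hC

/-- Distance of `P_t f` to the stationary mean. -/
lemma aux_ergodic {P : ℝ → X → Measure X} (hP : IsMarkovSemigroup P) {γ : ℝ}
    (hA3 : CondA3 P γ) {μstar : Measure X} [IsProbabilityMeasure μstar]
    (hinv : ∀ t, 0 ≤ t → measAct P t μstar = μstar) {x₀ : X}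
    (hm : Integrable (fun x => dist x₀ x) μstar)
    {t : ℝ} (ht : 0 ≤ t) {f : X → ℝ} {L C : ℝ} (hL0 : 0 ≤ L)
    (hL : ∀ x y, |f x - f y| ≤ L * dist x y) (hC : ∀ x, |f x| ≤ C) (x : X) :
    |funAct P t f x - ∫ y, f y ∂μstar| ≤
      L * Real.exp (-γ * t) * (dist x₀ x + ∫ y, dist x₀ y ∂μstar) := by
  have hfm : Measurable f := (aux_lip_cont hL).measurable
  have hi : Integrable (funAct P t f) μstar :=
    aux_bdd_integrable (aux_meas_funAct' hP hfm t) (aux_funAct_bdd hP ht hC)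
  have e : funAct P t f x - ∫ y, f y ∂μstar =
      ∫ y, (funAct P t f x - funAct P t f y) ∂μstar := by
    rw [integral_sub (integrable_const _) hi]
    conv_lhs => rw [← hinv t ht]
    rw [aux_integral_measAct hP ht hfm hC]
    simp
  rw [e]
  have hLe : 0 ≤ L * Real.exp (-γ * t) := mul_nonneg hL0 (Real.exp_pos _).le
  calc _ ≤ ∫ y, |funAct P t f x - funAct P t f y| ∂μstar := abs_integral_le_integral_abs
    _ ≤ ∫ y, L * Real.exp (-γ * t) * (dist x₀ x + dist x₀ y) ∂μstar := by
        refine integral_mono ((integrable_const _).sub hi).abs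
          (((integrable_const _).add hm).const_mul _) fun y => ?_
        refine (aux_contract hP hA3 ht hL0 hL x y).trans ?_
        refine mul_le_mul_of_nonneg_left ?_ hLe
        have := dist_triangle x x₀ y
        rwa [dist_comm x x₀] at this
    _ = _ := by
        rw [integral_const_mul, integral_add (integrable_const _) hm]; simp

/-! ## Moments and the corrector -/

lemma aux_integrable_of_lintegral {E : Type*} [MeasurableSpace E] {ν : Measure E}
    {f : E → ℝ} (hf : Measurable f) (h0 : ∀ x, 0 ≤ f x) {M : ℝ} (hM : 0 ≤ M)
    (h : ∫⁻ x, ENNReal.ofReal (f x) ∂ν ≤ ENNReal.ofReal M) :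
    Integrable f ν ∧ ∫ x, f x ∂ν ≤ M := by
  have hi : Integrable f ν := by
    refine ⟨hf.aestronglyMeasurable, ?_⟩
    rw [hasFiniteIntegral_iff_ofReal (Eventually.of_forall h0)]
    exact h.trans_lt ENNReal.ofReal_lt_top
  refine ⟨hi, ?_⟩
  rw [← ofReal_integral_eq_lintegral_ofReal hi (Eventually.of_forall h0)] at h
  exact (ENNReal.ofReal_le_ofReal_iff hM).1 h

lemma aux_rpow_bound {v ζ : ℝ} (hv : 0 ≤ v) (hζ : 2 < ζ) : v ^ 2 ≤ 1 + v ^ ζ := by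
  rcases le_total v 1 with h | h
  · have : v ^ 2 ≤ 1 := pow_le_one₀ hv h
    have := Real.rpow_nonneg hv ζ
    linarith
  · have : v ^ (2 : ℝ) ≤ v ^ ζ := Real.rpow_le_rpow_of_exponent_le h hζ.le
    rw [Real.rpow_two] at this
    linarith

lemma aux_moment_mu {P : ℝ → X → Measure X} (hP : IsMarkovSemigroup P) {μ : Measure X}
    [IsProbabilityMeasure μ] {x₀ : X} {ζ : ℝ} (hA4 : CondA4 P μ x₀ ζ) :
    ∃ M2 : ℝ, 0 ≤ M2 ∧ ∀ t, 0 ≤ t → Integrable (fun x => dist x₀ x ^ 2) (measAct P t μ) ∧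
      ∫ x, dist x₀ x ^ 2 ∂(measAct P t μ) ≤ M2 := by
  obtain ⟨hζ, M, hM⟩ := hA4
  refine ⟨1 + max M 0, by positivity, fun t ht => ?_⟩
  haveI := aux_prob_measAct hP (ν := μ) ht
  refine aux_integrable_of_lintegral (by fun_prop) (fun x => by positivity) (by positivity) ?_
  calc ∫⁻ x, ENNReal.ofReal (dist x₀ x ^ 2) ∂(measAct P t μ)
      ≤ ∫⁻ x, (1 + ENNReal.ofReal (dist x₀ x ^ ζ)) ∂(measAct P t μ) := by
        refine lintegral_mono fun x => ?_
        rw [← ENNReal.ofReal_one, ← ENNReal.ofReal_add zero_le_one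
          (Real.rpow_nonneg dist_nonneg _)]
        exact ENNReal.ofReal_le_ofReal (aux_rpow_bound dist_nonneg hζ)
    _ ≤ 1 + ENNReal.ofReal M := by
        rw [lintegral_add_left measurable_const]
        simpa using hM t ht
    _ ≤ _ := by
        rw [ENNReal.ofReal_add zero_le_one (le_max_right _ _), ENNReal.ofReal_one]
        gcongr
        exact le_max_left _ _

lemma aux_weak {P : ℝ → X → Measure X} (hP : IsMarkovSemigroup P) {γ : ℝ}
    (hA3 : CondA3 P γ) {μ μstar : Measure X} [IsProbabilityMeasure μ] [IsProbabilityMeasure μstar]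
    (hinv : ∀ t, 0 ≤ t → measAct P t μstar = μstar) (x₀ : X)
    {f : X → ℝ} {L C : ℝ} (hL0 : 0 ≤ L)
    (hL : ∀ x y, |f x - f y| ≤ L * dist x y) (hC : ∀ x, |f x| ≤ C) :
    Tendsto (fun n : ℕ => ∫ x, f x ∂(measAct P n μ)) atTop (𝓝 (∫ x, f x ∂μstar)) := by
  have hfm : Measurable f := (aux_lip_cont hL).measurable
  have hγ := hA3.2.1
  have key : ∀ ν : Measure X, IsProbabilityMeasure ν →
      Tendsto (fun n : ℕ => ∫ x, (funAct P n f x - funAct P n f x₀) ∂ν) atTop (𝓝 0) := by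
    intro ν _
    have : Tendsto (fun n : ℕ => ∫ x, (funAct P n f x - funAct P n f x₀) ∂ν) atTop
        (𝓝 (∫ x, (0 : ℝ) ∂ν)) := by
      refine tendsto_integral_of_dominated_convergence (fun _ => C + C) ?_ (integrable_const _)
        ?_ ?_
      · intro n
        exact ((aux_meas_funAct' hP hfm n).sub measurable_const).aestronglyMeasurable
      · intro n
        refine Eventually.of_forall fun x => ?_
        have a := aux_funAct_bdd hP (Nat.cast_nonneg n) hC x
        have b := aux_funAct_bdd hP (Nat.cast_nonneg n) hC x₀
        exact (abs_sub _ _).trans (add_le_add a b)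
      · refine Eventually.of_forall fun x => ?_
        have h1 : Tendsto (fun n : ℕ => L * Real.exp (-γ * n) * dist x x₀) atTop (𝓝 0) := by
          have : Tendsto (fun n : ℕ => Real.exp (-γ * n)) atTop (𝓝 0) := by
            refine Real.tendsto_exp_atBot.comp ?_
            refine Tendsto.const_mul_atTop_of_neg (by linarith) tendsto_natCast_atTop_atTop
          simpa using (this.const_mul L).mul_const (dist x x₀)
        exact squeeze_zero_norm (fun n => aux_contract hP hA3 (Nat.cast_nonneg n) hL0 hL x x₀) h1
    simpa using this
  have e : ∀ ν : Measure X, IsProbabilityMeasure ν → ∀ n : ℕ,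
      ∫ x, (funAct P n f x - funAct P n f x₀) ∂ν =
        ∫ x, f x ∂(measAct P n ν) - funAct P n f x₀ := by
    intro ν _ n
    rw [integral_sub (aux_bdd_integrable (aux_meas_funAct' hP hfm n)
      (aux_funAct_bdd hP (Nat.cast_nonneg n) hC)) (integrable_const _),
      aux_integral_measAct hP (Nat.cast_nonneg n) hfm hC]
    simp
  have h := (key μ inferInstance).sub (key μstar inferInstance)
  simp only [e μ inferInstance, e μstar inferInstance, sub_sub_sub_cancel_right, sub_zero] at h
  have h' : Tendsto (fun n : ℕ => ∫ x, f x ∂(measAct P n μ) - ∫ x, f x ∂μstar) atTop (𝓝 0) := by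
    refine h.congr fun n => ?_
    rw [hinv n (Nat.cast_nonneg n)]
  exact tendsto_sub_nhds_zero_iff.1 h'

lemma aux_moment_star {P : ℝ → X → Measure X} (hP : IsMarkovSemigroup P) {γ : ℝ}
    (hA3 : CondA3 P γ) {μ μstar : Measure X} [IsProbabilityMeasure μ] [IsProbabilityMeasure μstar]
    (hinv : ∀ t, 0 ≤ t → measAct P t μstar = μstar) {x₀ : X} {M2 : ℝ} (hM0 : 0 ≤ M2)
    (hM : ∀ t, 0 ≤ t → Integrable (fun x => dist x₀ x ^ 2) (measAct P t μ) ∧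
      ∫ x, dist x₀ x ^ 2 ∂(measAct P t μ) ≤ M2) :
    Integrable (fun x => dist x₀ x ^ 2) μstar ∧ ∫ x, dist x₀ x ^ 2 ∂μstar ≤ M2 := by
  have hN : ∀ N : ℕ, ∫ x, (min (dist x₀ x) N) ^ 2 ∂μstar ≤ M2 := by
    intro N
    have h0 : ∀ x, 0 ≤ min (dist x₀ x) (N : ℝ) := fun x => le_min dist_nonneg (Nat.cast_nonneg N)
    have h := aux_weak (f := fun x => (min (dist x₀ x) (N : ℝ)) ^ 2) (μ := μ) hP hA3 hinv x₀
      (L := 2 * N) (C := (N : ℝ) ^ 2) (by positivity) (fun x y => by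
        have a : |min (dist x₀ x) (N : ℝ) - min (dist x₀ y) N| ≤ dist x y := by
          refine (abs_min_sub_min_le_max _ _ _ _).trans ?_
          rw [sub_self, abs_zero]
          refine max_le ?_ dist_nonneg
          rw [dist_comm x₀ x, dist_comm x₀ y]
          exact abs_dist_sub_le x y x₀
        have b : |min (dist x₀ x) (N : ℝ) + min (dist x₀ y) N| ≤ 2 * N := by
          rw [abs_of_nonneg (add_nonneg (h0 x) (h0 y))]
          linarith [min_le_right (dist x₀ x) (N : ℝ), min_le_right (dist x₀ y) (N : ℝ)]
        rw [sq_sub_sq, abs_mul]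
        exact mul_le_mul b a (abs_nonneg _) (by positivity)) (fun x => by
        rw [abs_of_nonneg (sq_nonneg _)]
        exact pow_le_pow_left₀ (h0 x) (min_le_right _ _) 2)
    refine le_of_tendsto h (Eventually.of_forall fun n => ?_)
    obtain ⟨hi, hb⟩ := hM n (Nat.cast_nonneg n)
    haveI := aux_prob_measAct hP (ν := μ) (Nat.cast_nonneg (α := ℝ) n)
    refine le_trans (integral_mono_of_nonneg (Eventually.of_forall fun x => sq_nonneg _) hi
      (Eventually.of_forall fun x => ?_)) hb
    exact pow_le_pow_left₀ (h0 x) (min_le_left _ _) 2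
  refine aux_integrable_of_lintegral (by fun_prop) (fun x => by positivity) hM0 ?_
  have hlim : ∀ x, liminf (fun N : ℕ => ENNReal.ofReal ((min (dist x₀ x) N) ^ 2)) atTop =
      ENNReal.ofReal (dist x₀ x ^ 2) := by
    intro x
    refine Tendsto.liminf_eq ?_
    refine tendsto_const_nhds.congr' ?_
    filter_upwards [eventually_ge_atTop ⌈dist x₀ x⌉₊] with N hN'
    rw [min_eq_left ((Nat.le_ceil _).trans (by exact_mod_cast hN'))]
  simp_rw [← hlim]
  refine (lintegral_liminf_le fun N => by fun_prop).trans ?_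
  refine liminf_le_of_le (by isBoundedDefault) fun b hb => ?_
  obtain ⟨N, hbN⟩ := hb.exists
  refine hbN.trans ?_
  rw [← ofReal_integral_eq_lintegral_ofReal]
  · exact ENNReal.ofReal_le_ofReal (hN N)
  · refine aux_bdd_integrable (C := (N : ℝ) ^ 2) (by fun_prop) fun x => ?_
    rw [abs_of_nonneg (sq_nonneg _)]
    exact pow_le_pow_left₀ (le_min dist_nonneg (Nat.cast_nonneg N)) (min_le_right _ _) 2
  · exact Eventually.of_forall fun x => sq_nonneg _

lemma aux_sq_to_one {E : Type*} [MeasurableSpace E] {ν : Measure E} [IsFiniteMeasure ν]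
    {f : E → ℝ} (hf : Measurable f) (h : Integrable (fun x => f x ^ 2) ν) : Integrable f ν := by
  refine Integrable.mono' ((integrable_const (1 : ℝ)).add h) hf.aestronglyMeasurable
    (Eventually.of_forall fun x => ?_)
  simp only [Real.norm_eq_abs, Pi.add_apply]
  nlinarith [sq_abs (f x), sq_nonneg (|f x| - 1), abs_nonneg (f x)]

lemma aux_corrector_lip {P : ℝ → X → Measure X} (hP : IsMarkovSemigroup P) {γ : ℝ}
    (hA3 : CondA3 P γ) {μstar : Measure X} [IsProbabilityMeasure μstar]
    (hinv : ∀ t, 0 ≤ t → measAct P t μstar = μstar) {x₀ : X}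
    (hm : Integrable (fun x => dist x₀ x) μstar)
    {g : X → ℝ} {K C : ℝ} (hK0 : 0 ≤ K)
    (hK : ∀ x y, |g x - g y| ≤ K * dist x y) (hC : ∀ x, |g x| ≤ C)
    (hmean : ∫ x, g x ∂μstar = 0) :
    ∀ x y, |corrector P g x - corrector P g y| ≤ (K / γ) * dist x y := by
  have hγ := hA3.2.1
  have hgm : Measurable g := (aux_lip_cont hK).measurable
  have hexp : IntegrableOn (fun t : ℝ => Real.exp (-γ * t)) (Ioi 0) :=
    integrableOn_exp_mul_Ioi (by linarith) 0
  have hintg : ∀ x, IntegrableOn (fun t => funAct P t g x) (Ioi 0) := by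
    intro x
    refine Integrable.mono' ((hexp.const_mul K).mul_const (dist x₀ x + ∫ y, dist x₀ y ∂μstar))
      ?_ ?_
    · exact ((aux_meas_funAct hP hgm).comp
        (measurable_id.prodMk measurable_const)).aestronglyMeasurable
    · filter_upwards [ae_restrict_mem measurableSet_Ioi] with t ht
      have := aux_ergodic hP hA3 hinv hm (le_of_lt ht) hK0 hK hC x
      rw [hmean, sub_zero] at this
      exact this
  intro x y
  unfold corrector
  rw [← integral_sub (hintg x) (hintg y)]
  calc |∫ t in Ioi (0 : ℝ), (funAct P t g x - funAct P t g y)|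
      ≤ ∫ t in Ioi (0 : ℝ), |funAct P t g x - funAct P t g y| := abs_integral_le_integral_abs
    _ ≤ ∫ t in Ioi (0 : ℝ), K * Real.exp (-γ * t) * dist x y := by
        refine setIntegral_mono_on ((hintg x).sub (hintg y)).abs
          ((hexp.const_mul K).mul_const _) measurableSet_Ioi fun t ht => ?_
        exact aux_contract hP hA3 (le_of_lt ht) hK0 hK x y
    _ = _ := by
        rw [integral_mul_const, integral_const_mul, integral_exp_mul_Ioi (by linarith) 0]
        simp
        left; field_simp

/-! ## Markov property with frozen past -/

lemma aux_meas_Phi {Φ : ℝ → Ω → X} (h : Measurable fun p : ℝ × Ω => Φ p.1 p.2) (t : ℝ) :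
    Measurable (Φ t) := h.comp (measurable_const.prodMk measurable_id)

lemma aux_filt_le {Φ : ℝ → Ω → X} (h : Measurable fun p : ℝ × Ω => Φ p.1 p.2) (t : ℝ) :
    natFiltration Φ t ≤ (inferInstance : MeasurableSpace Ω) :=
  iSup₂_le fun u _ => (aux_meas_Phi h u).comap_le

lemma aux_filt_mono (Φ : ℝ → Ω → X) {s t : ℝ} (hst : s ≤ t) :
    natFiltration Φ s ≤ natFiltration Φ t :=
  iSup₂_le fun u hu => le_iSup₂_of_le (f := fun u (_ : u ∈ Set.Icc (0 : ℝ) t) =>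
    MeasurableSpace.comap (Φ u) inferInstance) u ⟨hu.1, hu.2.trans hst⟩ le_rfl

lemma aux_adapted (Φ : ℝ → Ω → X) {s t : ℝ} (hs : 0 ≤ s) (hst : s ≤ t) :
    Measurable[natFiltration Φ t] (Φ s) := by
  have : MeasurableSpace.comap (Φ s) inferInstance ≤ natFiltration Φ t :=
    le_iSup₂_of_le (f := fun u (_ : u ∈ Set.Icc (0 : ℝ) t) =>
      MeasurableSpace.comap (Φ u) inferInstance) s ⟨hs, hst⟩ le_rfl
  exact (comap_measurable (Φ s)).mono this le_rfl

lemma aux_freeze {P : ℝ → X → Measure X} (hP : IsMarkovSemigroup P) {ℙ : Measure Ω}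
    [IsProbabilityMeasure ℙ] {ν : Measure X} {Φ : ℝ → Ω → X} (hΦ : IsMarkovProcess P Φ ℙ ν)
    {E : Type*} [MeasurableSpace E] {t h : ℝ} (ht : 0 ≤ t) (hh : 0 ≤ h)
    {Y : Ω → E} (hY : Measurable[natFiltration Φ t] Y) {f : E × X → ℝ} (hf : Measurable f)
    {C : ℝ} (hC : ∀ p, |f p| ≤ C) :
    ∫ ω, f (Y ω, Φ (t + h) ω) ∂ℙ = ∫ ω, (∫ z, f (Y ω, z) ∂(P h (Φ t ω))) ∂ℙ := by
  have hle := aux_filt_le hΦ.jointMeas t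
  have hYm : Measurable Y := hY.mono hle le_rfl
  have hΦt := aux_meas_Phi hΦ.jointMeas t
  have hΦh := aux_meas_Phi hΦ.jointMeas (t + h)
  haveI := aux_ker_markov hP hh
  let κ : ProbabilityTheory.Kernel (E × X) X := (aux_ker hP h).comap Prod.snd measurable_snd
  haveI : ProbabilityTheory.IsMarkovKernel κ := by
    dsimp only [κ]; infer_instance
  have hκ : ∀ p, κ p = P h p.2 := fun p => rfl
  let ρ : Measure (E × X) := ℙ.map (fun ω => (Y ω, Φ t ω))
  haveI : IsProbabilityMeasure ρ := Measure.isProbabilityMeasure_map (hYm.prodMk hΦt).aemeasurable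
  have hq : Measurable (fun p : (E × X) × X => (p.1.1, p.2)) := by fun_prop
  have heq : ℙ.map (fun ω => (Y ω, Φ (t + h) ω)) =
      (ρ.compProd κ).map (fun p : (E × X) × X => (p.1.1, p.2)) := by
    haveI : IsProbabilityMeasure (ℙ.map (fun ω => (Y ω, Φ (t + h) ω))) :=
      Measure.isProbabilityMeasure_map (hYm.prodMk hΦh).aemeasurable
    refine Measure.ext_prod fun {s A} hs hA => ?_
    rw [Measure.map_apply (hYm.prodMk hΦh) (hs.prod hA), Measure.map_apply hq (hs.prod hA)]
    have e1 : (fun p : (E × X) × X => (p.1.1, p.2)) ⁻¹' (s ×ˢ A) = (s ×ˢ univ) ×ˢ A := by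
      ext p; simp
    rw [e1, Measure.compProd_apply_prod (hs.prod MeasurableSet.univ) hA]
    have hmA : Measurable (fun x => P h x A) :=
      (Measure.measurable_coe hA).comp (aux_meas_P hP h)
    rw [setLIntegral_map (hs.prod MeasurableSet.univ) (by
      simp only [hκ]; exact hmA.comp measurable_snd) (hYm.prodMk hΦt)]
    have e2 : (fun ω => (Y ω, Φ t ω)) ⁻¹' (s ×ˢ univ) = Y ⁻¹' s := by ext ω; simp
    rw [e2]
    simp only [hκ]
    have hind : Measurable (A.indicator (fun _ => (1 : ℝ))) := measurable_const.indicator hA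
    have hb : ∀ x, |A.indicator (fun _ => (1 : ℝ)) x| ≤ 1 := fun x => by
      by_cases hx : x ∈ A <;> simp [hx]
    have hmk := hΦ.markov (A.indicator (fun _ => (1 : ℝ))) hind ⟨1, hb⟩ t h ht hh
    have hintg : Integrable (fun ω => A.indicator (fun _ => (1 : ℝ)) (Φ (t + h) ω)) ℙ :=
      aux_bdd_integrable (hind.comp hΦh) (fun ω => hb _)
    have hset := setIntegral_condExp hle hintg (hY hs)
    rw [← setIntegral_congr_ae (g := fun ω => (ℙ[(fun ω =>
      A.indicator (fun _ => (1 : ℝ)) (Φ (t + h) ω)) | natFiltration Φ t]) ω) (hYm hs)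
      (hmk.mono fun ω hω _ => hω)] at hset
    have e3 : ∀ x, funAct P h (A.indicator (fun _ => (1 : ℝ))) x = (P h x A).toReal := by
      intro x
      simp only [funAct]
      rw [integral_indicator hA]
      simp [Measure.real]
    simp only [e3] at hset
    rw [integral_toReal (f := fun ω => P h (Φ t ω) A) (hmA.comp hΦt).aemeasurable (Eventually.of_forall fun ω => by
      haveI := hP.prob h hh (Φ t ω)
      exact measure_lt_top _ _)] at hset
    have e4 : ∫ ω in Y ⁻¹' s, A.indicator (fun _ => (1 : ℝ)) (Φ (t + h) ω) ∂ℙ =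
        (ℙ ((fun ω => (Y ω, Φ (t + h) ω)) ⁻¹' (s ×ˢ A))).toReal := by
      have : (fun ω => A.indicator (fun _ => (1 : ℝ)) (Φ (t + h) ω)) =
          (Φ (t + h) ⁻¹' A).indicator (fun _ => (1 : ℝ)) := by
        ext ω; rfl
      rw [this, integral_indicator (hΦh hA), Measure.restrict_restrict (hΦh hA)]
      simp [Measure.real]
      congr 1
      congr 1
      ext ω; simp [and_comm]
    rw [e4] at hset
    refine ((ENNReal.toReal_eq_toReal_iff' ?_ (measure_ne_top _ _)).1 hset).symm
    refine ne_of_lt (lt_of_le_of_lt (lintegral_mono (g := fun _ => 1) fun ω => ?_) ?_)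
    · haveI := hP.prob h hh (Φ t ω)
      exact prob_le_one
    · simp
  have hcm : Measurable (fun p : (E × X) × X => f (p.1.1, p.2)) := hf.comp hq
  calc ∫ ω, f (Y ω, Φ (t + h) ω) ∂ℙ
      = ∫ p, f p ∂(ℙ.map (fun ω => (Y ω, Φ (t + h) ω))) :=
        (integral_map (hYm.prodMk hΦh).aemeasurable hf.aestronglyMeasurable).symm
    _ = ∫ p, f (p.1.1, p.2) ∂(ρ.compProd κ) := by
        rw [heq, integral_map hq.aemeasurable hf.aestronglyMeasurable]
    _ = ∫ p, (∫ z, f (p.1, z) ∂(κ p)) ∂ρ :=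
        Measure.integral_compProd (aux_bdd_integrable hcm fun p => hC _)
    _ = _ := by
        rw [integral_map (hYm.prodMk hΦt).aemeasurable]
        · rfl
        · exact (StronglyMeasurable.integral_kernel_prod_right' (κ := κ)
            hcm.stronglyMeasurable).aestronglyMeasurable

/-! ## Iterated step operator -/

lemma aux_freeze_mul {P : ℝ → X → Measure X} (hP : IsMarkovSemigroup P) {ℙ : Measure Ω}
    [IsProbabilityMeasure ℙ] {ν : Measure X} {Φ : ℝ → Ω → X} (hΦ : IsMarkovProcess P Φ ℙ ν)
    {E : Type*} [MeasurableSpace E] {t h : ℝ} (ht : 0 ≤ t) (hh : 0 ≤ h)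
    {B : Ω → ℝ} (hB : Measurable[natFiltration Φ t] B) {CB : ℝ} (hCB : ∀ ω, |B ω| ≤ CB)
    {Y : Ω → E} (hY : Measurable[natFiltration Φ t] Y) {f : E × X → ℝ} (hf : Measurable f)
    {C : ℝ} (hC : ∀ p, |f p| ≤ C) :
    ∫ ω, B ω * f (Y ω, Φ (t + h) ω) ∂ℙ =
      ∫ ω, B ω * (∫ z, f (Y ω, z) ∂(P h (Φ t ω))) ∂ℙ := by
  have hclip : ∀ ω, max (-CB) (min (B ω) CB) = B ω := fun ω => by
    have := abs_le.1 (hCB ω)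
    rw [min_eq_left this.2, max_eq_right this.1]
  rcases isEmpty_or_nonempty Ω with hΩ | ⟨⟨ω₀⟩⟩
  · simp [integral_of_isEmpty]
  have hCB0 : 0 ≤ CB := (abs_nonneg _).trans (hCB ω₀)
  have hBY : Measurable[natFiltration Φ t] (fun ω => (B ω, Y ω)) := by
    exact Measurable.prodMk hB hY
  have hF : Measurable (fun p : (ℝ × E) × X => max (-CB) (min p.1.1 CB) * f (p.1.2, p.2)) := by
    fun_prop
  have := aux_freeze hP hΦ ht hh hBY hF (C := CB * C) (fun p => by
    rw [abs_mul]
    refine mul_le_mul ?_ (hC _) (abs_nonneg _) hCB0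
    rw [abs_le]
    exact ⟨le_max_left _ _, max_le (by linarith) (min_le_right _ _)⟩)
  simp only [hclip] at this
  rw [this]
  simp_rw [integral_const_mul]

/-- one Riemann step -/
def stepT (P : ℝ → X → Measure X) (g : X → ℝ) (m : ℕ) (W : ℝ → X → ℝ) (a : ℝ) (y : X) : ℝ :=
  ∫ z, W (a + g z / m) z ∂(P (1 / (m : ℝ)) y)

/-- bounded jointly Lipschitz functions -/
structure ClsW (C La Ly : ℝ) (W : ℝ → X → ℝ) : Prop where
  hLa : 0 ≤ La
  hLy : 0 ≤ Ly
  bdd : ∀ a y, |W a y| ≤ C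
  lip : ∀ a a' y y', |W a y - W a' y'| ≤ La * |a - a'| + Ly * dist y y'

lemma ClsW.measurable {C La Ly : ℝ} {W : ℝ → X → ℝ} (h : ClsW C La Ly W) :
    Measurable (fun p : ℝ × X => W p.1 p.2) := by
  have : LipschitzWith (La + Ly).toNNReal (fun p : ℝ × X => W p.1 p.2) :=
    LipschitzWith.of_dist_le_mul fun p q => by
      rw [Real.coe_toNNReal _ (add_nonneg h.hLa h.hLy), Real.dist_eq, add_mul]
      refine (h.lip p.1 q.1 p.2 q.2).trans (add_le_add ?_ ?_)
      · refine mul_le_mul_of_nonneg_left ?_ h.hLa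
        rw [← Real.dist_eq]
        exact le_max_left _ _
      · exact mul_le_mul_of_nonneg_left (le_max_right _ _) h.hLy
  exact this.continuous.measurable

lemma ClsW.step {P : ℝ → X → Measure X} (hP : IsMarkovSemigroup P) {γ : ℝ}
    (hA3 : CondA3 P γ) {g : X → ℝ} {K : ℝ} (hK0 : 0 ≤ K)
    (hK : ∀ x y, |g x - g y| ≤ K * dist x y) (m : ℕ)
    {C La Ly : ℝ} {W : ℝ → X → ℝ} (h : ClsW C La Ly W) :
    ClsW C La (Ly + La * K / m) (stepT P g m W) := by
  have hm : (0 : ℝ) ≤ 1 / (m : ℝ) := by positivity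
  have hg : Measurable g := (aux_lip_cont hK).measurable
  have hγ := hA3.2.1
  have hW := h.measurable
  have hLa := h.hLa
  have hLy := h.hLy
  have hmeas : ∀ a, Measurable (fun z => W (a + g z / m) z) := fun a =>
    hW.comp ((measurable_const.add (hg.div_const _)).prodMk measurable_id)
  refine ⟨hLa, by positivity, fun a y => ?_, fun a a' y y' => ?_⟩
  · haveI := hP.prob _ hm y
    exact aux_bdd_integral fun z => h.bdd _ _
  · haveI := hP.prob _ hm y
    have h1 : |stepT P g m W a y - stepT P g m W a' y| ≤ La * |a - a'| := by
      unfold stepT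
      rw [← integral_sub (aux_bdd_integrable (hmeas a) fun z => h.bdd _ _)
        (aux_bdd_integrable (hmeas a') fun z => h.bdd _ _)]
      refine aux_bdd_integral fun z => ?_
      have := h.lip (a + g z / m) (a' + g z / m) z z
      simpa using this
    have h2 : |stepT P g m W a' y - stepT P g m W a' y'| ≤
        (Ly + La * K / m) * Real.exp (-γ * (1 / (m : ℝ))) * dist y y' := by
      refine aux_contract hP hA3 hm (f := fun z => W (a' + g z / m) z) (by positivity)
        (fun z z' => ?_) y y'
      refine (h.lip _ _ z z').trans ?_
      have e : a' + g z / m - (a' + g z' / m) = (g z - g z') / m := by ring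
      rw [e, abs_div, Nat.abs_cast]
      have : La * (|g z - g z'| / m) ≤ La * (K * dist z z' / m) := by
        gcongr
        exact hK z z'
      calc _ ≤ La * (K * dist z z' / m) + Ly * dist z z' := by linarith
        _ = _ := by ring
    have h3 : Real.exp (-γ * (1 / (m : ℝ))) ≤ 1 := by
      rw [Real.exp_le_one_iff]
      have : 0 ≤ γ * (1 / (m : ℝ)) := by positivity
      linarith
    have h4 : (Ly + La * K / m) * Real.exp (-γ * (1 / (m : ℝ))) * dist y y' ≤
        (Ly + La * K / m) * dist y y' := by
      refine mul_le_mul_of_nonneg_right ?_ dist_nonneg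
      exact mul_le_of_le_one_right (by positivity) h3
    have h5 := abs_sub_le (stepT P g m W a y) (stepT P g m W a' y) (stepT P g m W a' y')
    linarith

lemma ClsW.iter {P : ℝ → X → Measure X} (hP : IsMarkovSemigroup P) {γ : ℝ}
    (hA3 : CondA3 P γ) {g : X → ℝ} {K : ℝ} (hK0 : 0 ≤ K)
    (hK : ∀ x y, |g x - g y| ≤ K * dist x y) (m : ℕ) (j : ℕ)
    {C La Ly : ℝ} {W : ℝ → X → ℝ} (h : ClsW C La Ly W) :
    ClsW C La (Ly + j * (La * K / m)) ((stepT P g m)^[j] W) := by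
  induction j with
  | zero => simpa using h
  | succ j ih =>
    rw [Function.iterate_succ_apply']
    have := ih.step hP hA3 hK0 hK m
    have e : Ly + ((j + 1 : ℕ) : ℝ) * (La * K / m) = Ly + j * (La * K / m) + La * K / m := by
      push_cast; ring
    rwa [e]

lemma aux_iter_expect {P : ℝ → X → Measure X} (hP : IsMarkovSemigroup P) {γ : ℝ}
    (hA3 : CondA3 P γ) {g : X → ℝ} {K : ℝ} (hK0 : 0 ≤ K)
    (hK : ∀ x y, |g x - g y| ≤ K * dist x y) {ℙ : Measure Ω}
    [IsProbabilityMeasure ℙ] {ν : Measure X} {Φ : ℝ → Ω → X} (hΦ : IsMarkovProcess P Φ ℙ ν)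
    {t : ℝ} (ht : 0 ≤ t) {B : Ω → ℝ} (hB : Measurable[natFiltration Φ t] B) {CB : ℝ}
    (hCB : ∀ ω, |B ω| ≤ CB) {A : Ω → ℝ} (hA : Measurable[natFiltration Φ t] A) (m : ℕ) (j : ℕ) :
    ∀ {C La Ly : ℝ} {W : ℝ → X → ℝ}, ClsW C La Ly W →
    ∫ ω, B ω * W (A ω + ∑ i ∈ Finset.range j, g (Φ (t + (i + 1) / m) ω) / m)
        (Φ (t + j / m) ω) ∂ℙ = ∫ ω, B ω * ((stepT P g m)^[j] W) (A ω) (Φ t ω) ∂ℙ := by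
  have hg : Measurable g := (aux_lip_cont hK).measurable
  induction j with
  | zero => intro C La Ly W h; simp
  | succ j ih =>
    intro C La Ly W h
    rw [Function.iterate_succ_apply, ← ih (h.step hP hA3 hK0 hK m)]
    have htj : (0 : ℝ) ≤ t + j / m := by positivity
    have htt : t ≤ t + j / m := by
      have : (0 : ℝ) ≤ j / m := by positivity
      linarith
    have hle := aux_filt_mono Φ htt
    have hY : Measurable[natFiltration Φ (t + j / m)]
        (fun ω => A ω + ∑ i ∈ Finset.range j, g (Φ (t + (i + 1) / m) ω) / m) := by
      refine Measurable.add (hA.mono hle le_rfl) ?_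
      refine Finset.measurable_fun_sum _ fun i hi => ?_
      have hij : ((i : ℝ) + 1) ≤ j := by
        have := Finset.mem_range.1 hi
        exact_mod_cast this
      have h1 : Measurable[natFiltration Φ (t + j / m)] (Φ (t + (i + 1) / m)) :=
        aux_adapted Φ (by positivity) (by gcongr)
      exact (hg.comp h1).div_const _
    have hW := h.measurable
    have := aux_freeze_mul hP hΦ htj (h := 1 / (m : ℝ)) (by positivity) (hB.mono hle le_rfl) hCB hY
      (f := fun p : ℝ × X => W (p.1 + g p.2 / m) p.2) (by
        exact hW.comp ((measurable_fst.add ((hg.comp measurable_snd).div_const _)).prodMk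
          measurable_snd)) (C := C) (fun p => h.bdd _ _)
    have e : t + ((j + 1 : ℕ) : ℝ) / m = t + j / m + 1 / m := by push_cast; ring
    have e' : t + ((j : ℝ) + 1) / m = t + j / m + 1 / m := by ring
    simp only [Finset.sum_range_succ, e, e', ← add_assoc]
    exact this

/-! ## Riemann sums -/

lemma aux_rightcont {P : ℝ → X → Measure X} (hP : IsMarkovSemigroup P) (hA1 : CondA1 P)
    {g : X → ℝ} (hg : Continuous g) {C : ℝ} (hC : ∀ x, |g x| ≤ C) {ℙ : Measure Ω}
    [IsProbabilityMeasure ℙ] {ν : Measure X} {Φ : ℝ → Ω → X} (hΦ : IsMarkovProcess P Φ ℙ ν)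
    {s : ℝ} (hs : 0 ≤ s) :
    ContinuousWithinAt (fun u => ∫ ω, |g (Φ s ω) - g (Φ u ω)| ∂ℙ) (Ici s) s := by
  rw [← continuousWithinAt_Ioi_iff_Ici, ContinuousWithinAt]
  simp only [sub_self, abs_zero, integral_zero]
  have hb : ∀ x y, |(|g x - g y|)| ≤ C + C := fun x y => by
    rw [abs_abs]
    exact (abs_sub _ _).trans (add_le_add (hC x) (hC y))
  have hF : Measurable (fun p : X × X => |g p.1 - g p.2|) := by
    have := hg.measurable
    fun_prop
  have key : Tendsto (fun h => ∫ ω, (∫ z, |g (Φ s ω) - g z| ∂(P h (Φ s ω))) ∂ℙ) (𝓝[>] 0)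
      (𝓝 (∫ ω, (0 : ℝ) ∂ℙ)) := by
    refine tendsto_integral_filter_of_dominated_convergence (fun _ => C + C) ?_ ?_
      (integrable_const _) ?_
    · filter_upwards [self_mem_nhdsWithin] with h hh
      haveI := aux_ker_markov hP (le_of_lt hh)
      exact ((StronglyMeasurable.integral_kernel_prod_right' (κ := aux_ker hP h)
        hF.stronglyMeasurable).measurable.comp (aux_meas_Phi hΦ.jointMeas s)).aestronglyMeasurable
    · filter_upwards [self_mem_nhdsWithin] with h hh
      refine Eventually.of_forall fun ω => ?_
      haveI := hP.prob h (le_of_lt hh) (Φ s ω)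
      exact aux_bdd_integral fun z => hb _ _
    · refine Eventually.of_forall fun ω => ?_
      have := hA1 (fun z => |g (Φ s ω) - g z|) (by fun_prop) ⟨C + C, fun z => hb _ _⟩ (Φ s ω)
      simpa [funAct] using this
  rw [integral_zero] at key
  have hsub : Tendsto (fun u => u - s) (𝓝[>] s) (𝓝[>] 0) := by
    refine tendsto_nhdsWithin_iff.2 ⟨?_, ?_⟩
    · have : Tendsto (fun u : ℝ => u - s) (𝓝 s) (𝓝 (s - s)) := tendsto_id.sub_const s
      rw [sub_self] at this
      exact this.mono_left nhdsWithin_le_nhds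
    · filter_upwards [self_mem_nhdsWithin] with u hu
      exact mem_Ioi.2 (sub_pos.2 (mem_Ioi.1 hu))
  refine (key.comp hsub).congr' ?_
  filter_upwards [self_mem_nhdsWithin] with u hu
  have := aux_freeze hP hΦ hs (h := u - s) (sub_nonneg.2 (le_of_lt hu)) (aux_adapted Φ hs le_rfl)
    hF (fun p => hb _ _)
  simp only [Function.comp]
  rw [← this]
  simp

/-- Riemann sums with right end points -/
def rsum (g : X → ℝ) (Φ : ℝ → Ω → X) (m : ℕ) (t : ℝ) (ω : Ω) : ℝ :=
  ∑ i ∈ Finset.range m, g (Φ (t + (i + 1) / m) ω) / m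

lemma aux_rsum_bdd {g : X → ℝ} {C : ℝ} (hC : ∀ x, |g x| ≤ C) (hC0 : 0 ≤ C)
    (Φ : ℝ → Ω → X) (m : ℕ) (t : ℝ) (ω : Ω) : |rsum g Φ m t ω| ≤ C := by
  unfold rsum
  refine (Finset.abs_sum_le_sum_abs _ _).trans ?_
  have : ∀ i ∈ Finset.range m, |g (Φ (t + (i + 1) / m) ω) / m| ≤ C / m := fun i _ => by
    rw [abs_div, Nat.abs_cast]
    gcongr
    exact hC _
  refine (Finset.sum_le_sum this).trans ?_
  rw [Finset.sum_const, Finset.card_range, nsmul_eq_mul]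
  rcases Nat.eq_zero_or_pos m with rfl | hm
  · simpa using hC0
  · have : (m : ℝ) ≠ 0 := by positivity
    rw [mul_div_cancel₀ _ this]

lemma aux_ceil {m : ℕ} (hm : 0 < m) {t s : ℝ} {i : ℕ} (h1 : t + i / m < s)
    (h2 : s ≤ t + (i + 1) / m) : ⌈(m : ℝ) * (s - t)⌉₊ = i + 1 := by
  have hm' : (0 : ℝ) < m := by positivity
  rw [Nat.ceil_eq_iff (by simp)]
  constructor
  · have : (i : ℝ) / m < s - t := by linarith
    rw [div_lt_iff₀ hm'] at this
    simp only [Nat.add_sub_cancel]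
    linarith
  · have : s - t ≤ ((i : ℝ) + 1) / m := by linarith
    rw [le_div_iff₀ hm'] at this
    push_cast
    linarith

/-- the right end point of the cell of mesh `1/m` containing `s` -/
def tauR (t : ℝ) (m : ℕ) (s : ℝ) : ℝ := t + (⌈(m : ℝ) * (s - t)⌉₊ : ℝ) / m

lemma tauR_meas (t : ℝ) (m : ℕ) : Measurable (tauR t m) := by
  unfold tauR
  have : Measurable fun s : ℝ => ⌈(m : ℝ) * (s - t)⌉₊ := Nat.measurable_ceil.comp (by fun_prop)
  have h2 : Measurable fun s : ℝ => (⌈(m : ℝ) * (s - t)⌉₊ : ℝ) :=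
    (measurable_from_top (f := fun n : ℕ => (n : ℝ))).comp this
  fun_prop

lemma tauR_tendsto {t s : ℝ} (hst : 0 ≤ s - t) :
    Tendsto (fun m => tauR t m s) atTop (𝓝[Ici s] s) := by
  have hlow : ∀ᶠ m : ℕ in atTop, s ≤ tauR t m s := by
    filter_upwards [eventually_gt_atTop 0] with m hm
    have hm' : (0 : ℝ) < m := by positivity
    have := Nat.le_ceil ((m : ℝ) * (s - t))
    have h2 : s - t ≤ (⌈(m : ℝ) * (s - t)⌉₊ : ℝ) / m := by
      rw [le_div_iff₀ hm']; linarith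
    simp only [tauR]; linarith
  refine tendsto_nhdsWithin_iff.2 ⟨?_, hlow⟩
  have h0 : Tendsto (fun m : ℕ => s + 1 / (m : ℝ)) atTop (𝓝 s) := by
    simpa using tendsto_one_div_atTop_nhds_zero_nat.const_add s
  refine tendsto_of_tendsto_of_tendsto_of_le_of_le' tendsto_const_nhds h0 hlow ?_
  filter_upwards [eventually_gt_atTop 0] with m hm
  have hm' : (0 : ℝ) < m := by positivity
  have := Nat.ceil_lt_add_one (a := (m : ℝ) * (s - t)) (by positivity)
  have h2 : (⌈(m : ℝ) * (s - t)⌉₊ : ℝ) / m ≤ (s - t) + 1 / m := by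
    rw [div_le_iff₀ hm', add_mul, one_div, inv_mul_cancel₀ hm'.ne']; linarith
  simp only [tauR]; linarith

lemma aux_rsum_eq {g : X → ℝ} {Φ : ℝ → Ω → X} {t : ℝ} {m : ℕ} (hm : 0 < m) (ω : Ω)
    (hii2 : ∀ a b, IntervalIntegrable (fun s => g (Φ (tauR t m s) ω)) volume a b) :
    rsum g Φ m t ω = ∫ s in t..(t + 1), g (Φ (tauR t m s) ω) := by
  have hm' : (m : ℝ) ≠ 0 := by positivity
  have h := intervalIntegral.sum_integral_adjacent_intervals (μ := volume)
    (f := fun s => g (Φ (tauR t m s) ω)) (a := fun i : ℕ => t + (i : ℝ) / m) (n := m)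
    (fun k _ => hii2 _ _)
  simp only [Nat.cast_zero, zero_div, add_zero, div_self hm'] at h
  rw [← h]
  unfold rsum
  refine Finset.sum_congr rfl fun i _ => ?_
  have hle : t + (i : ℝ) / m ≤ t + ((i + 1 : ℕ) : ℝ) / m := by
    gcongr; simp
  rw [intervalIntegral.integral_of_le hle]
  have : ∫ s in Ioc (t + (i : ℝ) / m) (t + ((i + 1 : ℕ) : ℝ) / m), g (Φ (tauR t m s) ω) =
      ∫ s in Ioc (t + (i : ℝ) / m) (t + ((i + 1 : ℕ) : ℝ) / m),
        g (Φ (t + ((i : ℝ) + 1) / m) ω) := by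
    refine setIntegral_congr_fun measurableSet_Ioc fun s hs => ?_
    have hs2 : s ≤ t + ((i : ℝ) + 1) / m := by simpa using hs.2
    simp only [tauR, aux_ceil hm hs.1 hs2]
    push_cast
    rfl
  rw [this, ← intervalIntegral.integral_of_le hle, intervalIntegral.integral_const,
    smul_eq_mul]
  push_cast
  ring

attribute [irreducible] tauR

lemma aux_riemann {P : ℝ → X → Measure X} (hP : IsMarkovSemigroup P) (hA1 : CondA1 P)
    {g : X → ℝ} (hg : Continuous g) {C : ℝ} (hC : ∀ x, |g x| ≤ C) {ℙ : Measure Ω}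
    [IsProbabilityMeasure ℙ] {ν : Measure X} {Φ : ℝ → Ω → X} (hΦ : IsMarkovProcess P Φ ℙ ν)
    {t : ℝ} (ht : 0 ≤ t) :
    Tendsto (fun m : ℕ => ∫ ω, |(∫ s in t..(t + 1), g (Φ s ω)) - rsum g Φ m t ω| ∂ℙ) atTop
      (𝓝 0) := by
  have hgm := hg.measurable
  have hb : ∀ x y, |(|g x - g y|)| ≤ C + C := fun x y => by
    rw [abs_abs]
    exact (abs_sub _ _).trans (add_le_add (hC x) (hC y))
  have hτ : ∀ m, Measurable (tauR t m) := fun m => tauR_meas t m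
  have hJ := hΦ.jointMeas
  have hg1 : Measurable (fun p : ℝ × Ω => g (Φ p.1 p.2)) := hgm.comp hJ
  have hg2 : ∀ m, Measurable (fun p : ℝ × Ω => g (Φ (tauR t m p.1) p.2)) := fun m =>
    hgm.comp (hJ.comp (((hτ m).comp measurable_fst).prodMk measurable_snd))
  have hsec : ∀ ω, Measurable (fun s => g (Φ s ω)) := fun ω =>
    hg1.comp (measurable_prodMk_right (y := ω))
  have hsec2 : ∀ m ω, Measurable (fun s => g (Φ (tauR t m s) ω)) := fun m ω =>
    (hg2 m).comp (measurable_prodMk_right (y := ω))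
  have hii : ∀ ω a b, IntervalIntegrable (fun s => g (Φ s ω)) volume a b := fun ω a b =>
    ⟨aux_bdd_integrable (hsec ω) fun s => hC _, aux_bdd_integrable (hsec ω) fun s => hC _⟩
  have hii2 : ∀ m ω a b, IntervalIntegrable (fun s => g (Φ (tauR t m s) ω)) volume a b :=
    fun m ω a b => ⟨aux_bdd_integrable (hsec2 m ω) fun s => hC _,
      aux_bdd_integrable (hsec2 m ω) fun s => hC _⟩
  have hmain : Tendsto (fun m : ℕ => ∫ s in Ioc t (t + 1),
      (∫ ω, |g (Φ s ω) - g (Φ (tauR t m s) ω)| ∂ℙ)) atTop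
      (𝓝 (∫ s in Ioc t (t + 1), (0 : ℝ))) := by
    refine tendsto_integral_of_dominated_convergence (fun _ => C + C) ?_ (integrable_const _) ?_ ?_
    · intro m
      have : Measurable (fun p : ℝ × Ω => |g (Φ p.1 p.2) - g (Φ (tauR t m p.1) p.2)|) :=
        (hg1.sub (hg2 m)).abs
      exact this.stronglyMeasurable.integral_prod_right.aestronglyMeasurable
    · intro m
      exact Eventually.of_forall fun s => aux_bdd_integral fun ω => hb _ _
    · filter_upwards [ae_restrict_mem measurableSet_Ioc] with s hs
      have hc := aux_rightcont hP hA1 hg hC hΦ (s := s) (ht.trans hs.1.le)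
      have hτs := tauR_tendsto (t := t) (s := s) (by linarith [hs.1])
      have := Tendsto.comp hc hτs
      simpa [Function.comp_def] using this
  rw [integral_zero] at hmain
  refine squeeze_zero' (Eventually.of_forall fun m => integral_nonneg fun ω => abs_nonneg _) ?_
    hmain
  filter_upwards [eventually_gt_atTop 0] with m hm
  have hmeas : Measurable (fun p : ℝ × Ω => |g (Φ p.1 p.2) - g (Φ (tauR t m p.1) p.2)|) :=
    (hg1.sub (hg2 m)).abs
  have hswap := integral_integral_swap (μ := volume.restrict (Ioc t (t + 1))) (ν := ℙ)
    (f := fun s ω => |g (Φ s ω) - g (Φ (tauR t m s) ω)|)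
    (aux_bdd_integrable hmeas fun p => hb _ _)
  rw [hswap]
  have hintg : Integrable (fun ω => ∫ s in Ioc t (t + 1), |g (Φ s ω) - g (Φ (tauR t m s) ω)|) ℙ := by
    have : Integrable (fun p : ℝ × Ω => |g (Φ p.1 p.2) - g (Φ (tauR t m p.1) p.2)|)
      ((volume.restrict (Ioc t (t + 1))).prod ℙ) := aux_bdd_integrable hmeas fun p => hb _ _
    exact this.integral_prod_right
  refine integral_mono_of_nonneg (Eventually.of_forall fun ω => abs_nonneg _) hintg
    (Eventually.of_forall fun ω => ?_)
  simp only
  rw [aux_rsum_eq hm ω (hii2 m ω), ← intervalIntegral.integral_sub (hii ω _ _) (hii2 m ω _ _),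
    intervalIntegral.integral_of_le (by linarith)]
  exact abs_integral_le_integral_abs

/-! ## Truncated squares of increments -/

/-- truncated square -/
def uu (β z : ℝ) : ℝ := (min |z| β) ^ 2

lemma uu_nonneg (β z : ℝ) : 0 ≤ uu β z := sq_nonneg _

lemma uu_le_mul {β : ℝ} (hβ : 0 ≤ β) (z : ℝ) : uu β z ≤ β * |z| := by
  unfold uu
  rw [sq]
  exact mul_le_mul (min_le_right _ _) (min_le_left _ _) (le_min (abs_nonneg _) hβ) hβ

lemma uu_le_sq {β : ℝ} (hβ : 0 ≤ β) (z : ℝ) : uu β z ≤ z ^ 2 := by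
  unfold uu
  rw [← sq_abs z]
  exact pow_le_pow_left₀ (le_min (abs_nonneg _) hβ) (min_le_left _ _) 2

lemma uu_bdd {β : ℝ} (hβ : 0 ≤ β) (z : ℝ) : |uu β z| ≤ β ^ 2 := by
  rw [abs_of_nonneg (uu_nonneg _ _)]
  exact pow_le_pow_left₀ (le_min (abs_nonneg _) hβ) (min_le_right _ _) 2

lemma uu_lip {β : ℝ} (hβ : 0 ≤ β) (z z' : ℝ) : |uu β z - uu β z'| ≤ 2 * β * |z - z'| := by
  have h0 : ∀ z, 0 ≤ min |z| β := fun z => le_min (abs_nonneg _) hβ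
  unfold uu
  rw [sq_sub_sq, abs_mul]
  refine mul_le_mul ?_ ?_ (abs_nonneg _) (by positivity)
  · rw [abs_of_nonneg (add_nonneg (h0 z) (h0 z'))]
    linarith [min_le_right |z| β, min_le_right |z'| β]
  · refine (abs_min_sub_min_le_max _ _ _ _).trans ?_
    rw [sub_self, abs_zero]
    exact max_le (abs_abs_sub_abs_le_abs_sub z z') (abs_nonneg _)

lemma uu_meas (β : ℝ) : Measurable (uu β) := by
  unfold uu; fun_prop

/-- increments -/
def Zc (χ g : X → ℝ) (Φ : ℝ → Ω → X) (t : ℝ) (ω : Ω) : ℝ :=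
  χ (Φ (t + 1) ω) - χ (Φ t ω) + ∫ s in t..(t + 1), g (Φ s ω)

/-- discretized increments -/
def Zm (χ g : X → ℝ) (Φ : ℝ → Ω → X) (m : ℕ) (t : ℝ) (ω : Ω) : ℝ :=
  χ (Φ (t + 1) ω) - χ (Φ t ω) + rsum g Φ m t ω

/-- standing facts -/
structure Setup (P : ℝ → X → Measure X) (γ : ℝ) (μstar : Measure X) (x₀ : X) (g χ : X → ℝ)
    (K C Lx M2 : ℝ) : Prop where
  hP : IsMarkovSemigroup P
  hA1 : CondA1 P
  hA3 : CondA3 P γ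
  prob : IsProbabilityMeasure μstar
  hinv : ∀ t, 0 ≤ t → measAct P t μstar = μstar
  hm : Integrable (fun x => dist x₀ x) μstar
  hK0 : 0 ≤ K
  hK : ∀ x y, |g x - g y| ≤ K * dist x y
  hC0 : 0 ≤ C
  hC : ∀ x, |g x| ≤ C
  hLx0 : 0 ≤ Lx
  hLx : ∀ x y, |χ x - χ y| ≤ Lx * dist x y
  hM2 : 0 ≤ M2

/-- a process with bounded second moments -/
structure Proc (P : ℝ → X → Measure X) (Φ : ℝ → Ω → X) (ℙ : Measure Ω) (ν : Measure X)
    (x₀ : X) (M2 : ℝ) : Prop where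
  prob : IsProbabilityMeasure ℙ
  hΦ : IsMarkovProcess P Φ ℙ ν
  sqI : ∀ t, 0 ≤ t → Integrable (fun ω => dist x₀ (Φ t ω) ^ 2) ℙ
  sqB : ∀ t, 0 ≤ t → ∫ ω, dist x₀ (Φ t ω) ^ 2 ∂ℙ ≤ M2

/-- the one step function -/
def hfun (P : ℝ → X → Measure X) (g χ : X → ℝ) (β : ℝ) (m : ℕ) (x : X) : ℝ :=
  ((stepT P g m)^[m] (fun a y => uu β (a + χ y))) (-χ x) x

section
variable {P : ℝ → X → Measure X} {γ : ℝ} {μstar : Measure X} {x₀ : X} {g χ : X → ℝ}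
    {K C Lx M2 : ℝ}

lemma Setup.gm (S : Setup P γ μstar x₀ g χ K C Lx M2) : Measurable g :=
  (aux_lip_cont S.hK).measurable

lemma Setup.χm (S : Setup P γ μstar x₀ g χ K C Lx M2) : Measurable χ :=
  (aux_lip_cont S.hLx).measurable

lemma Setup.cls0 (S : Setup P γ μstar x₀ g χ K C Lx M2) {β : ℝ} (hβ : 0 ≤ β) :
    ClsW (β ^ 2) (2 * β) (2 * β * Lx) (fun a (y : X) => uu β (a + χ y)) := by
  have := S.hLx0
  refine ⟨by positivity, by positivity, fun a y => uu_bdd hβ _, fun a a' y y' => ?_⟩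
  refine (uu_lip hβ _ _).trans ?_
  have h1 : |a + χ y - (a' + χ y')| ≤ |a - a'| + Lx * dist y y' := by
    have e : a + χ y - (a' + χ y') = (a - a') + (χ y - χ y') := by ring
    rw [e]
    exact (abs_add_le _ _).trans (by linarith [S.hLx y y'])
  calc _ ≤ 2 * β * (|a - a'| + Lx * dist y y') := by gcongr
    _ = _ := by ring

lemma Setup.cls (S : Setup P γ μstar x₀ g χ K C Lx M2) {β : ℝ} (hβ : 0 ≤ β) {m : ℕ}
    (hm : 0 < m) :
    ClsW (β ^ 2) (2 * β) (2 * β * Lx + 2 * β * K)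
      ((stepT P g m)^[m] (fun a (y : X) => uu β (a + χ y))) := by
  have := (S.cls0 hβ).iter S.hP S.hA3 S.hK0 S.hK m m
  have hm' : (m : ℝ) ≠ 0 := by positivity
  rwa [mul_div_cancel₀ _ hm'] at this

lemma Setup.hfun_bdd (S : Setup P γ μstar x₀ g χ K C Lx M2) {β : ℝ} (hβ : 0 ≤ β) {m : ℕ}
    (hm : 0 < m) (x : X) : |hfun P g χ β m x| ≤ β ^ 2 := (S.cls hβ hm).bdd _ _

lemma Setup.hfun_lip (S : Setup P γ μstar x₀ g χ K C Lx M2) {β : ℝ} (hβ : 0 ≤ β) {m : ℕ}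
    (hm : 0 < m) (x y : X) :
    |hfun P g χ β m x - hfun P g χ β m y| ≤ (β * (2 * (2 * Lx + K))) * dist x y := by
  refine ((S.cls hβ hm).lip _ _ x y).trans ?_
  have : |-χ x - -χ y| ≤ Lx * dist x y := by
    rw [neg_sub_neg, abs_sub_comm]; exact S.hLx x y
  calc _ ≤ 2 * β * (Lx * dist x y) + (2 * β * Lx + 2 * β * K) * dist x y := by gcongr
    _ = _ := by ring

lemma Setup.hfun_meas (S : Setup P γ μstar x₀ g χ K C Lx M2) {β : ℝ} (hβ : 0 ≤ β) {m : ℕ}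
    (hm : 0 < m) : Measurable (hfun P g χ β m) :=
  (aux_lip_cont (S.hfun_lip hβ hm)).measurable

lemma Setup.Zm_adapted (S : Setup P γ μstar x₀ g χ K C Lx M2) (Φ : ℝ → Ω → X) {m : ℕ}
    (hm : 0 < m) {t : ℝ} (ht : 0 ≤ t) : Measurable[natFiltration Φ (t + 1)] (Zm χ g Φ m t) := by
  have hm' : (0 : ℝ) < m := by positivity
  have h1 : Measurable[natFiltration Φ (t + 1)] (Φ (t + 1)) :=
    aux_adapted Φ (by positivity) le_rfl
  have h2 : Measurable[natFiltration Φ (t + 1)] (Φ t) := aux_adapted Φ ht (by linarith)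
  refine Measurable.add (Measurable.sub (S.χm.comp h1) (S.χm.comp h2)) ?_
  refine Finset.measurable_fun_sum _ fun i hi => ?_
  have hij : ((i : ℝ) + 1) / m ≤ 1 := by
    rw [div_le_one hm']
    have := Finset.mem_range.1 hi
    exact_mod_cast this
  have h3 : Measurable[natFiltration Φ (t + 1)] (Φ (t + (i + 1) / m)) :=
    aux_adapted Φ (by positivity) (by linarith)
  exact (S.gm.comp h3).div_const _

lemma Setup.Zm_meas (S : Setup P γ μstar x₀ g χ K C Lx M2) {Φ : ℝ → Ω → X}
    {ℙ : Measure Ω} {ν : Measure X} (Q : Proc P Φ ℙ ν x₀ M2) {m : ℕ}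
    (hm : 0 < m) {t : ℝ} (ht : 0 ≤ t) : Measurable (Zm χ g Φ m t) :=
  (S.Zm_adapted Φ hm ht).mono (aux_filt_le Q.hΦ.jointMeas _) le_rfl

lemma Setup.Zc_meas (S : Setup P γ μstar x₀ g χ K C Lx M2) {Φ : ℝ → Ω → X}
    {ℙ : Measure Ω} {ν : Measure X} (Q : Proc P Φ ℙ ν x₀ M2) {t : ℝ} :
    Measurable (Zc χ g Φ t) := by
  refine Measurable.add (Measurable.sub (S.χm.comp (aux_meas_Phi Q.hΦ.jointMeas _))
    (S.χm.comp (aux_meas_Phi Q.hΦ.jointMeas _))) ?_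
  simp_rw [intervalIntegral.integral_of_le (show t ≤ t + 1 by linarith)]
  have h : Measurable (fun p : ℝ × Ω => g (Φ p.1 p.2)) := S.gm.comp Q.hΦ.jointMeas
  exact (h.stronglyMeasurable.integral_prod_left (μ := volume.restrict (Ioc t (t + 1)))).measurable

lemma Setup.expect (S : Setup P γ μstar x₀ g χ K C Lx M2) {Φ : ℝ → Ω → X}
    {ℙ : Measure Ω} {ν : Measure X} (Q : Proc P Φ ℙ ν x₀ M2) {β : ℝ} (hβ : 0 ≤ β) {m : ℕ}
    (hm : 0 < m) {t : ℝ} (ht : 0 ≤ t) {B : Ω → ℝ} (hB : Measurable[natFiltration Φ t] B)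
    {CB : ℝ} (hCB : ∀ ω, |B ω| ≤ CB) :
    ∫ ω, B ω * uu β (Zm χ g Φ m t ω) ∂ℙ = ∫ ω, B ω * hfun P g χ β m (Φ t ω) ∂ℙ := by
  haveI := Q.prob
  have hA : Measurable[natFiltration Φ t] (fun ω => - χ (Φ t ω)) :=
    (S.χm.comp (aux_adapted Φ ht le_rfl)).neg
  have h := aux_iter_expect S.hP S.hA3 S.hK0 S.hK Q.hΦ ht hB hCB hA m m (S.cls0 hβ)
  have hm' : (m : ℝ) ≠ 0 := by positivity
  rw [div_self hm'] at h
  unfold hfun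
  rw [← h]
  refine integral_congr_ae (Eventually.of_forall fun ω => ?_)
  simp only [Zm, rsum]
  congr 2
  ring

lemma Setup.expect_star (S : Setup P γ μstar x₀ g χ K C Lx M2) {Φ : ℝ → Ω → X}
    {ℙ : Measure Ω} (Q : Proc P Φ ℙ μstar x₀ M2) {β : ℝ} (hβ : 0 ≤ β) {m : ℕ}
    (hm : 0 < m) :
    ∫ ω, uu β (Zm χ g Φ m 0 ω) ∂ℙ = ∫ x, hfun P g χ β m x ∂μstar := by
  have h := S.expect Q hβ hm le_rfl (B := fun _ => 1) measurable_const (CB := 1) (by simp)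
  simp only [one_mul] at h
  rw [h]
  conv_rhs => rw [← Q.hΦ.init]
  rw [integral_map (aux_meas_Phi Q.hΦ.jointMeas 0).aemeasurable
    (S.hfun_meas hβ hm).aestronglyMeasurable]

lemma Setup.cov_m (S : Setup P γ μstar x₀ g χ K C Lx M2) {Φ : ℝ → Ω → X}
    {ℙ : Measure Ω} {ν : Measure X} (Q : Proc P Φ ℙ ν x₀ M2) {β : ℝ} (hβ : 0 ≤ β) {m : ℕ}
    (hm : 0 < m) {t r : ℝ} (ht : 0 ≤ t) (hr : 0 ≤ r) {B : Ω → ℝ}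
    (hB : Measurable[natFiltration Φ t] B)
    {CB : ℝ} (hCB : ∀ ω, |B ω| ≤ CB) {b : ℝ} (hb : 0 ≤ b) {G : Ω → ℝ}
    (hBG : ∀ ω, |B ω| ≤ b * G ω) (hG : ∀ ω, dist x₀ (Φ t ω) + ∫ y, dist x₀ y ∂μstar ≤ G ω)
    (hGi : Integrable (fun ω => G ω ^ 2) ℙ) {C2 : ℝ} (hG2 : ∫ ω, G ω ^ 2 ∂ℙ ≤ C2) :
    |∫ ω, B ω * (uu β (Zm χ g Φ m (t + r) ω) - ∫ x, hfun P g χ β m x ∂μstar) ∂ℙ| ≤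
      (β * (2 * (2 * Lx + K))) * Real.exp (-γ * r) * b * C2 := by
  haveI := Q.prob
  haveI := S.prob
  have hle := aux_filt_le Q.hΦ.jointMeas t
  have hBm : Measurable B := hB.mono hle le_rfl
  set c := ∫ x, hfun P g χ β m x ∂μstar with hc
  set h := hfun P g χ β m with hh
  have hhm := S.hfun_meas hβ hm
  have hhb := S.hfun_bdd (β := β) hβ hm
  have hBi : Integrable B ℙ := aux_bdd_integrable hBm hCB
  have hΦt := aux_meas_Phi Q.hΦ.jointMeas t
  have hL0 : 0 ≤ β * (2 * (2 * Lx + K)) := by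
    have := S.hLx0
    have := S.hK0
    positivity
  have bddmul : ∀ f : Ω → ℝ, Measurable f → (∀ ω, |f ω| ≤ β ^ 2) →
      Integrable (fun ω => B ω * f ω) ℙ := by
    intro f hf hfb
    refine Integrable.mono' (hBi.abs.mul_const (β ^ 2)) (hBm.mul hf).aestronglyMeasurable
      (Eventually.of_forall fun ω => ?_)
    rw [Real.norm_eq_abs, abs_mul]
    exact mul_le_mul_of_nonneg_left (hfb ω) (abs_nonneg _)
  have e1 : ∫ ω, B ω * uu β (Zm χ g Φ m (t + r) ω) ∂ℙ =
      ∫ ω, B ω * funAct P r h (Φ t ω) ∂ℙ := by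
    rw [S.expect Q hβ hm (by positivity) (hB.mono (aux_filt_mono Φ (by linarith)) le_rfl) hCB]
    exact aux_freeze_mul S.hP Q.hΦ ht hr hB hCB (Y := fun _ => ()) measurable_const
      (f := fun p : Unit × X => h p.2) (hhm.comp measurable_snd) (fun p => hhb _)
  have e2 : ∫ ω, B ω * (uu β (Zm χ g Φ m (t + r) ω) - c) ∂ℙ =
      ∫ ω, B ω * (funAct P r h (Φ t ω) - c) ∂ℙ := by
    simp_rw [mul_sub]
    rw [integral_sub _ (hBi.mul_const c), integral_sub _ (hBi.mul_const c), e1]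
    · exact bddmul _ ((aux_meas_funAct' S.hP hhm r).comp hΦt)
        fun ω => aux_funAct_bdd S.hP hr hhb _
    · exact bddmul _ ((uu_meas β).comp (S.Zm_meas Q hm (by positivity))) fun ω => uu_bdd hβ _
  rw [e2]
  refine abs_integral_le_integral_abs.trans ?_
  have hexp := Real.exp_pos (-γ * r)
  calc ∫ ω, |B ω * (funAct P r h (Φ t ω) - c)| ∂ℙ
      ≤ ∫ ω, (β * (2 * (2 * Lx + K))) * Real.exp (-γ * r) * b * G ω ^ 2 ∂ℙ := by
        refine integral_mono_of_nonneg (Eventually.of_forall fun ω => abs_nonneg _)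
          (hGi.const_mul _) (Eventually.of_forall fun ω => ?_)
        have h1 := aux_ergodic S.hP S.hA3 S.hinv S.hm hr hL0 (S.hfun_lip hβ hm) hhb (Φ t ω)
        have hG0 : 0 ≤ G ω := le_trans (add_nonneg dist_nonneg
          (integral_nonneg fun _ => dist_nonneg)) (hG ω)
        have h2 : |funAct P r h (Φ t ω) - c| ≤
            (β * (2 * (2 * Lx + K))) * Real.exp (-γ * r) * G ω :=
          h1.trans (mul_le_mul_of_nonneg_left (hG ω) (by positivity))
        simp only
        rw [abs_mul]
        calc _ ≤ (b * G ω) * ((β * (2 * (2 * Lx + K))) * Real.exp (-γ * r) * G ω) :=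
              mul_le_mul (hBG ω) h2 (abs_nonneg _) (by positivity)
          _ = _ := by ring
    _ ≤ _ := by
        rw [integral_const_mul]
        exact mul_le_mul_of_nonneg_left hG2 (by positivity)

end

/-! ## Covariance bounds -/

lemma aux_prod_limit {ℙ : Measure Ω} [IsProbabilityMeasure ℙ] {f g : ℕ → Ω → ℝ} {F G : Ω → ℝ}
    {A B : ℝ} (hf : ∀ᶠ m in atTop, Measurable (f m)) (hg : ∀ᶠ m in atTop, Measurable (g m))
    (hF : Measurable F) (hG : Measurable G)
    (hfb : ∀ᶠ m in atTop, ∀ ω, |f m ω| ≤ A) (hgb : ∀ᶠ m in atTop, ∀ ω, |g m ω| ≤ A)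
    (hFb : ∀ ω, |F ω| ≤ B) (hGb : ∀ ω, |G ω| ≤ B)
    (h1 : Tendsto (fun m => ∫ ω, |f m ω - F ω| ∂ℙ) atTop (𝓝 0))
    (h2 : Tendsto (fun m => ∫ ω, |g m ω - G ω| ∂ℙ) atTop (𝓝 0)) :
    Tendsto (fun m => ∫ ω, f m ω * g m ω ∂ℙ) atTop (𝓝 (∫ ω, F ω * G ω ∂ℙ)) := by
  rw [tendsto_iff_norm_sub_tendsto_zero]
  have hlim : Tendsto (fun m => A * ∫ ω, |g m ω - G ω| ∂ℙ + B * ∫ ω, |f m ω - F ω| ∂ℙ) atTop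
      (𝓝 0) := by
    simpa using (h2.const_mul A).add (h1.const_mul B)
  refine squeeze_zero' (Eventually.of_forall fun m => norm_nonneg _) ?_ hlim
  filter_upwards [hf, hg, hfb, hgb] with m hf hg hfb hgb
  have i1 : Integrable (fun ω => |g m ω - G ω|) ℙ :=
    aux_bdd_integrable (hg.sub hG).abs (C := A + B) fun ω => by
      rw [abs_abs]; exact (abs_sub _ _).trans (add_le_add (hgb ω) (hGb ω))
  have i2 : Integrable (fun ω => |f m ω - F ω|) ℙ :=
    aux_bdd_integrable (hf.sub hF).abs (C := A + B) fun ω => by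
      rw [abs_abs]; exact (abs_sub _ _).trans (add_le_add (hfb ω) (hFb ω))
  have i3 : Integrable (fun ω => f m ω * g m ω) ℙ :=
    aux_bdd_integrable (hf.mul hg) (C := A * A) fun ω => by
      rw [abs_mul]; exact mul_le_mul (hfb ω) (hgb ω) (abs_nonneg _) ((abs_nonneg _).trans (hfb ω))
  have i4 : Integrable (fun ω => F ω * G ω) ℙ :=
    aux_bdd_integrable (hF.mul hG) (C := B * B) fun ω => by
      rw [abs_mul]; exact mul_le_mul (hFb ω) (hGb ω) (abs_nonneg _) ((abs_nonneg _).trans (hFb ω))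
  rw [← integral_sub i3 i4, Real.norm_eq_abs, ← integral_const_mul, ← integral_const_mul,
    ← integral_add (i1.const_mul _) (i2.const_mul _)]
  refine abs_integral_le_integral_abs.trans ?_
  refine integral_mono (i3.sub i4).abs ((i1.const_mul _).add (i2.const_mul _)) fun ω => ?_
  simp only
  have e : f m ω * g m ω - F ω * G ω = f m ω * (g m ω - G ω) + G ω * (f m ω - F ω) := by ring
  rw [e]
  refine (abs_add_le _ _).trans ?_
  rw [abs_mul, abs_mul]
  gcongr
  · exact hfb ω
  · exact hGb ω

lemma aux_int_lin {ℙ : Measure Ω} [IsProbabilityMeasure ℙ] {f h : Ω → ℝ} (hf : Integrable f ℙ)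
    (hh : Integrable h ℙ) (a b : ℝ) :
    ∫ ω, (a * (f ω + h ω) + b) ∂ℙ = a * (∫ ω, f ω ∂ℙ + ∫ ω, h ω ∂ℙ) + b := by
  have h1 : Integrable (fun ω => f ω + h ω) ℙ := hf.add hh
  rw [integral_add (h1.const_mul a) (integrable_const _), integral_const_mul, integral_add hf hh]
  simp

section
variable {P : ℝ → X → Measure X} {γ : ℝ} {μstar : Measure X} {x₀ : X} {g χ : X → ℝ}
    {K C Lx M2 : ℝ}

lemma Setup.χ_diff (S : Setup P γ μstar x₀ g χ K C Lx M2) (x y : X) :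
    |χ x - χ y| ≤ Lx * (dist x₀ y + dist x₀ x) := by
  refine (S.hLx x y).trans (mul_le_mul_of_nonneg_left ?_ S.hLx0)
  rw [add_comm, dist_comm x₀ x]
  exact dist_triangle _ _ _

lemma Setup.Zm_bd (S : Setup P γ μstar x₀ g χ K C Lx M2) (Φ : ℝ → Ω → X) (m : ℕ) (t : ℝ) (ω : Ω) :
    |Zm χ g Φ m t ω| ≤ Lx * (dist x₀ (Φ t ω) + dist x₀ (Φ (t + 1) ω)) + C :=
  (abs_add_le _ _).trans (add_le_add (S.χ_diff _ _) (aux_rsum_bdd S.hC S.hC0 Φ m t ω))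

lemma Setup.Zc_bd (S : Setup P γ μstar x₀ g χ K C Lx M2) (Φ : ℝ → Ω → X) (t : ℝ) (ω : Ω) :
    |Zc χ g Φ t ω| ≤ Lx * (dist x₀ (Φ t ω) + dist x₀ (Φ (t + 1) ω)) + C := by
  refine (abs_add_le _ _).trans (add_le_add (S.χ_diff _ _) ?_)
  have := intervalIntegral.norm_integral_le_of_norm_le_const (a := t) (b := t + 1)
    (f := fun s => g (Φ s ω)) (C := C) (fun s _ => S.hC _)
  simpa using this

lemma Proc.V1 {Φ : ℝ → Ω → X} {ℙ : Measure Ω} {ν : Measure X} (Q : Proc P Φ ℙ ν x₀ M2) {t : ℝ}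
    (ht : 0 ≤ t) : Integrable (fun ω => dist x₀ (Φ t ω)) ℙ ∧
      ∫ ω, dist x₀ (Φ t ω) ∂ℙ ≤ 1 + M2 := by
  haveI := Q.prob
  have hm := aux_meas_Phi Q.hΦ.jointMeas t
  have hi : Integrable (fun ω => dist x₀ (Φ t ω)) ℙ :=
    aux_sq_to_one (by fun_prop) (Q.sqI t ht)
  refine ⟨hi, ?_⟩
  calc ∫ ω, dist x₀ (Φ t ω) ∂ℙ ≤ ∫ ω, (1 + dist x₀ (Φ t ω) ^ 2) ∂ℙ := by
        refine integral_mono hi ((integrable_const _).add (Q.sqI t ht)) fun ω => ?_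
        simp only
        nlinarith [sq_nonneg (dist x₀ (Φ t ω) - 1), dist_nonneg (x := x₀) (y := Φ t ω)]
    _ ≤ _ := by
        rw [integral_add (integrable_const _) (Q.sqI t ht)]
        simpa using Q.sqB t ht

lemma Setup.star_bd (S : Setup P γ μstar x₀ g χ K C Lx M2) {Φ : ℝ → Ω → X} {ℙ : Measure Ω}
    {ν : Measure X} (Q : Proc P Φ ℙ ν x₀ M2) {β : ℝ} (hβ : 0 ≤ β) {t : ℝ} (ht : 0 ≤ t) {Z : Ω → ℝ}
    (hZ : ∀ ω, |Z ω| ≤ Lx * (dist x₀ (Φ t ω) + dist x₀ (Φ (t + 1) ω)) + C) :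
    |∫ ω, uu β (Z ω) ∂ℙ| ≤ β * (2 * Lx * (1 + M2) + C) := by
  haveI := Q.prob
  have h0 := Q.V1 ht
  have h1 := Q.V1 (t := t + 1) (by positivity)
  rw [abs_of_nonneg (integral_nonneg fun ω => uu_nonneg _ _)]
  have hi : Integrable (fun ω => Lx * (dist x₀ (Φ t ω) + dist x₀ (Φ (t + 1) ω)) + C) ℙ :=
    ((h0.1.add h1.1).const_mul _).add (integrable_const _)
  calc ∫ ω, uu β (Z ω) ∂ℙ ≤
      ∫ ω, β * (Lx * (dist x₀ (Φ t ω) + dist x₀ (Φ (t + 1) ω)) + C) ∂ℙ := by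
        refine integral_mono_of_nonneg (Eventually.of_forall fun ω => uu_nonneg _ _)
          (hi.const_mul _) (Eventually.of_forall fun ω => ?_)
        exact (uu_le_mul hβ _).trans (mul_le_mul_of_nonneg_left (hZ ω) hβ)
    _ = β * (Lx * (∫ ω, dist x₀ (Φ t ω) ∂ℙ + ∫ ω, dist x₀ (Φ (t + 1) ω) ∂ℙ) + C) := by
        rw [integral_const_mul, aux_int_lin h0.1 h1.1]
    _ ≤ _ := by
        refine mul_le_mul_of_nonneg_left ?_ hβ
        have := mul_le_mul_of_nonneg_left (add_le_add h0.2 h1.2) S.hLx0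
        linarith

lemma Setup.uu_limit (S : Setup P γ μstar x₀ g χ K C Lx M2) {Φ : ℝ → Ω → X} {ℙ : Measure Ω}
    {ν : Measure X} (Q : Proc P Φ ℙ ν x₀ M2) {β : ℝ} (hβ : 0 ≤ β) {t : ℝ} (ht : 0 ≤ t) :
    Tendsto (fun m : ℕ => ∫ ω, |uu β (Zm χ g Φ m t ω) - uu β (Zc χ g Φ t ω)| ∂ℙ) atTop (𝓝 0) := by
  haveI := Q.prob
  have h := (aux_riemann S.hP S.hA1 (aux_lip_cont S.hK) S.hC Q.hΦ ht).const_mul (2 * β)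
  rw [mul_zero] at h
  refine squeeze_zero' (Eventually.of_forall fun m => integral_nonneg fun ω => abs_nonneg _) ?_ h
  filter_upwards [eventually_gt_atTop 0] with m hm
  rw [← integral_const_mul]
  have e : ∀ ω, (∫ s in t..(t + 1), g (Φ s ω)) - rsum g Φ m t ω =
      Zc χ g Φ t ω - Zm χ g Φ m t ω := fun ω => by simp only [Zc, Zm]; ring
  have hi : Integrable (fun ω => |(∫ s in t..(t + 1), g (Φ s ω)) - rsum g Φ m t ω|) ℙ := by
    refine aux_bdd_integrable (C := C + C) ?_ fun ω => ?_
    · simp_rw [e]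
      exact ((S.Zc_meas Q).sub (S.Zm_meas Q hm ht)).abs
    · rw [abs_abs]
      refine (abs_sub _ _).trans (add_le_add ?_ (aux_rsum_bdd S.hC S.hC0 Φ m t ω))
      have := intervalIntegral.norm_integral_le_of_norm_le_const (a := t) (b := t + 1)
        (f := fun s => g (Φ s ω)) (C := C) (fun s _ => S.hC _)
      simpa using this
  refine integral_mono_of_nonneg (Eventually.of_forall fun ω => abs_nonneg _)
    (hi.const_mul _) (Eventually.of_forall fun ω => ?_)
  simp only
  rw [e ω, abs_sub_comm (Zc χ g Φ t ω)]
  exact uu_lip hβ _ _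

lemma Setup.c_limit (S : Setup P γ μstar x₀ g χ K C Lx M2) {Φ : ℝ → Ω → X} {ℙ : Measure Ω}
    (Q : Proc P Φ ℙ μstar x₀ M2) {β : ℝ} (hβ : 0 ≤ β) :
    Tendsto (fun m : ℕ => ∫ x, hfun P g χ β m x ∂μstar) atTop
      (𝓝 (∫ ω, uu β (Zc χ g Φ 0 ω) ∂ℙ)) := by
  haveI := Q.prob
  rw [tendsto_iff_norm_sub_tendsto_zero]
  refine squeeze_zero' (Eventually.of_forall fun m => norm_nonneg _) ?_ (S.uu_limit Q hβ le_rfl)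
  filter_upwards [eventually_gt_atTop 0] with m hm
  rw [← S.expect_star Q hβ hm, ← integral_sub, Real.norm_eq_abs]
  · exact abs_integral_le_integral_abs
  · exact aux_bdd_integrable ((uu_meas β).comp (S.Zm_meas Q hm le_rfl)) fun ω => uu_bdd hβ _
  · exact aux_bdd_integrable ((uu_meas β).comp (S.Zc_meas Q)) fun ω => uu_bdd hβ _

/-- The dominating function. -/
def GG (Φ : ℝ → Ω → X) (x₀ : X) (Lx D t : ℝ) (ω : Ω) : ℝ :=
  Lx * (dist x₀ (Φ t ω) + dist x₀ (Φ (t + 1) ω)) + dist x₀ (Φ (t + 1) ω) + D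

lemma Setup.GG_sq (S : Setup P γ μstar x₀ g χ K C Lx M2) {Φ : ℝ → Ω → X} {ℙ : Measure Ω}
    {ν : Measure X} (Q : Proc P Φ ℙ ν x₀ M2) (D : ℝ) {t : ℝ} (ht : 0 ≤ t) :
    Integrable (fun ω => GG Φ x₀ Lx D t ω ^ 2) ℙ ∧
      ∫ ω, GG Φ x₀ Lx D t ω ^ 2 ∂ℙ ≤ 3 * ((Lx + 1) ^ 2 * (M2 + M2) + D ^ 2) := by
  haveI := Q.prob
  have hm0 := aux_meas_Phi Q.hΦ.jointMeas t
  have hm1 := aux_meas_Phi Q.hΦ.jointMeas (t + 1)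
  have h0 := Q.sqI t ht
  have h1 := Q.sqI (t + 1) (by positivity)
  have hi : Integrable (fun ω => 3 * ((Lx + 1) ^ 2 *
      (dist x₀ (Φ t ω) ^ 2 + dist x₀ (Φ (t + 1) ω) ^ 2) + D ^ 2)) ℙ :=
    (((h0.add h1).const_mul _).add (integrable_const _)).const_mul _
  have hle : ∀ ω, GG Φ x₀ Lx D t ω ^ 2 ≤ 3 * ((Lx + 1) ^ 2 *
      (dist x₀ (Φ t ω) ^ 2 + dist x₀ (Φ (t + 1) ω) ^ 2) + D ^ 2) := by
    intro ω
    have hL := S.hLx0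
    have a0 : 0 ≤ dist x₀ (Φ t ω) := dist_nonneg
    unfold GG
    generalize dist x₀ (Φ t ω) = a at *
    generalize dist x₀ (Φ (t + 1) ω) = b at *
    have h3 : ∀ x y z : ℝ, (x + y + z) ^ 2 ≤ 3 * (x ^ 2 + y ^ 2 + z ^ 2) := fun x y z => by
      nlinarith [sq_nonneg (x - y), sq_nonneg (y - z), sq_nonneg (x - z)]
    have h4 := h3 (Lx * a) ((Lx + 1) * b) D
    have h5 : (Lx * a) ^ 2 ≤ (Lx + 1) ^ 2 * a ^ 2 := by
      rw [mul_pow]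
      exact mul_le_mul_of_nonneg_right (pow_le_pow_left₀ hL (by linarith) 2) (sq_nonneg _)
    have e : Lx * (a + b) + b + D = Lx * a + (Lx + 1) * b + D := by ring
    rw [e]
    nlinarith
  have hGm : Measurable (GG Φ x₀ Lx D t) := by unfold GG; fun_prop
  refine ⟨Integrable.mono' hi (hGm.pow_const 2).aestronglyMeasurable
    (Eventually.of_forall fun ω => ?_), ?_⟩
  · rw [Real.norm_eq_abs, abs_of_nonneg (sq_nonneg _)]; exact hle ω
  · refine (integral_mono_of_nonneg (Eventually.of_forall fun ω => sq_nonneg _) hi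
      (Eventually.of_forall hle)).trans ?_
    rw [integral_const_mul, aux_int_lin h0 h1]
    gcongr
    exacts [Q.sqB t ht, Q.sqB (t + 1) (by positivity)]

/-- centred truncated squares -/
def WW {Ω' : Type*} [MeasurableSpace Ω'] (χ g : X → ℝ) (Φ : ℝ → Ω → X) (Φ' : ℝ → Ω' → X)
    (ℙ' : Measure Ω') (β t : ℝ) (ω : Ω) : ℝ :=
  uu β (Zc χ g Φ t ω) - ∫ ω', uu β (Zc χ g Φ' 0 ω') ∂ℙ'

lemma Setup.cov {Ω' : Type*} [MeasurableSpace Ω'] (S : Setup P γ μstar x₀ g χ K C Lx M2)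
    {Φ : ℝ → Ω → X} {ℙ : Measure Ω} {ν : Measure X} (Q : Proc P Φ ℙ ν x₀ M2)
    {Φ' : ℝ → Ω' → X} {ℙ' : Measure Ω'} (Q' : Proc P Φ' ℙ' μstar x₀ M2) :
    ∃ C3 : ℝ, 0 ≤ C3 ∧ ∀ β β' : ℝ, 0 ≤ β → 0 ≤ β' → ∀ k l : ℕ, k ≤ l →
      |∫ ω, WW χ g Φ Φ' ℙ' β k ω * WW χ g Φ Φ' ℙ' β' l ω ∂ℙ| ≤
        C3 * (β * β') * Real.exp (-γ * ((l : ℝ) - k)) := by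
  haveI := Q.prob
  haveI := Q'.prob
  have hLx0 := S.hLx0
  have hK0 := S.hK0
  have hC0 := S.hC0
  have hM20 := S.hM2
  have hγ := S.hA3.2.1
  have hC1 : 0 ≤ ∫ y, dist x₀ y ∂μstar := integral_nonneg fun _ => dist_nonneg
  set C1 := ∫ y, dist x₀ y ∂μstar with hC1def
  set D := C + (2 * Lx * (1 + M2) + C) + C1 with hD
  set C2 := 3 * ((Lx + 1) ^ 2 * (M2 + M2) + D ^ 2) with hC2
  have hC20 : 0 ≤ C2 := by positivity
  -- domination
  have dom : ∀ (β c : ℝ) (t : ℝ) (ω : Ω) (Z : ℝ), 0 ≤ β → |c| ≤ β * (2 * Lx * (1 + M2) + C) →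
      |Z| ≤ Lx * (dist x₀ (Φ t ω) + dist x₀ (Φ (t + 1) ω)) + C →
      |uu β Z - c| ≤ β * GG Φ x₀ Lx D t ω := by
    intro β c t ω Z hβ hc hZ
    refine (abs_sub _ _).trans ?_
    rw [abs_of_nonneg (uu_nonneg _ _)]
    have h1 := (uu_le_mul hβ Z).trans (mul_le_mul_of_nonneg_left hZ hβ)
    refine (add_le_add h1 hc).trans ?_
    rw [← mul_add]
    refine mul_le_mul_of_nonneg_left ?_ hβ
    unfold GG
    rw [hD]
    linarith [dist_nonneg (x := x₀) (y := Φ (t + 1) ω)]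
  have hcstar : ∀ β, 0 ≤ β → |∫ ω', uu β (Zc χ g Φ' 0 ω') ∂ℙ'| ≤ β * (2 * Lx * (1 + M2) + C) :=
    fun β hβ => S.star_bd Q' hβ le_rfl (S.Zc_bd Φ' 0)
  have hcm : ∀ β, 0 ≤ β → ∀ m : ℕ, 0 < m →
      |∫ x, hfun P g χ β m x ∂μstar| ≤ β * (2 * Lx * (1 + M2) + C) := fun β hβ m hm => by
    rw [← S.expect_star Q' hβ hm]
    exact S.star_bd Q' hβ le_rfl (S.Zm_bd Φ' m 0)
  refine ⟨C2 + (2 * (2 * Lx + K)) * Real.exp γ * C2, by positivity, ?_⟩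
  intro β β' hβ hβ' k l hkl
  rcases hkl.eq_or_lt with rfl | hlt
  · have hk : (0 : ℝ) ≤ k := by positivity
    have hG := S.GG_sq Q D hk
    rw [sub_self, mul_zero, Real.exp_zero, mul_one]
    refine abs_integral_le_integral_abs.trans ?_
    calc _ ≤ ∫ ω, (β * β') * GG Φ x₀ Lx D k ω ^ 2 ∂ℙ := by
          refine integral_mono_of_nonneg (Eventually.of_forall fun ω => abs_nonneg _)
            (hG.1.const_mul _) (Eventually.of_forall fun ω => ?_)
          simp only
          rw [abs_mul]
          have a1 := dom β _ k ω _ hβ (hcstar β hβ) (S.Zc_bd Φ k ω)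
          have a2 := dom β' _ k ω _ hβ' (hcstar β' hβ') (S.Zc_bd Φ k ω)
          calc _ ≤ (β * GG Φ x₀ Lx D k ω) * (β' * GG Φ x₀ Lx D k ω) :=
                mul_le_mul a1 a2 (abs_nonneg _) ((abs_nonneg _).trans a1)
            _ = _ := by ring
      _ ≤ (β * β') * C2 := by
          rw [integral_const_mul]
          exact mul_le_mul_of_nonneg_left hG.2 (by positivity)
      _ ≤ _ := by
          have : 0 ≤ (2 * (2 * Lx + K)) * Real.exp γ * C2 := by positivity
          nlinarith [mul_nonneg hβ hβ']
  · have hk : (0 : ℝ) ≤ k := by positivity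
    have hl : (0 : ℝ) ≤ l := by positivity
    have hkl' : (k : ℝ) + 1 ≤ l := by exact_mod_cast hlt
    have hG := S.GG_sq Q D hk
    -- the limit
    have L1 : ∀ (β : ℝ) (t : ℝ), 0 ≤ β → 0 ≤ t →
        Tendsto (fun m : ℕ => ∫ ω, |(uu β (Zm χ g Φ m t ω) - ∫ x, hfun P g χ β m x ∂μstar) -
          WW χ g Φ Φ' ℙ' β t ω| ∂ℙ) atTop (𝓝 0) := by
      intro β t hβ ht
      have hc := S.c_limit Q' hβ
      rw [tendsto_iff_norm_sub_tendsto_zero] at hc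
      have hs := (S.uu_limit Q hβ ht).add hc
      rw [add_zero] at hs
      refine squeeze_zero' (Eventually.of_forall fun m => integral_nonneg fun ω => abs_nonneg _)
        ?_ hs
      filter_upwards [eventually_gt_atTop 0] with m hm
      have i1 : Integrable (fun ω => |uu β (Zm χ g Φ m t ω) - uu β (Zc χ g Φ t ω)|) ℙ :=
        (Integrable.sub
          (aux_bdd_integrable ((uu_meas β).comp (S.Zm_meas Q hm ht)) fun ω => uu_bdd hβ _)
          (aux_bdd_integrable ((uu_meas β).comp (S.Zc_meas Q)) fun ω => uu_bdd hβ _)).abs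
      calc _ ≤ ∫ ω, (|uu β (Zm χ g Φ m t ω) - uu β (Zc χ g Φ t ω)| +
            ‖∫ x, hfun P g χ β m x ∂μstar - ∫ ω', uu β (Zc χ g Φ' 0 ω') ∂ℙ'‖) ∂ℙ := by
            refine integral_mono_of_nonneg (Eventually.of_forall fun ω => abs_nonneg _)
              (i1.add (integrable_const _)) (Eventually.of_forall fun ω => ?_)
            simp only [WW]
            rw [Real.norm_eq_abs, sub_sub_sub_comm]
            exact abs_sub _ _
        _ = _ := by
            rw [integral_add i1 (integrable_const _)]
            simp
    have hWm : ∀ (β t : ℝ), Measurable (WW χ g Φ Φ' ℙ' β t) := fun β t =>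
      ((uu_meas β).comp (S.Zc_meas Q)).sub_const _
    set E := 2 * Lx * (1 + M2) + C with hE
    have hE0 : 0 ≤ E := by positivity
    set A := β ^ 2 + β * E + (β' ^ 2 + β' * E) with hA
    have hWb : ∀ (b t : ℝ), 0 ≤ b → b ^ 2 + b * E ≤ A → ∀ ω, |WW χ g Φ Φ' ℙ' b t ω| ≤ A :=
      fun b t hb hbA ω =>
        ((abs_sub _ _).trans (add_le_add (uu_bdd hb _) (hcstar b hb))).trans hbA
    have hmb : ∀ (b t : ℝ), 0 ≤ b → b ^ 2 + b * E ≤ A → ∀ m : ℕ, 0 < m → ∀ ω,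
        |uu b (Zm χ g Φ m t ω) - ∫ x, hfun P g χ b m x ∂μstar| ≤ A :=
      fun b t hb hbA m hm ω =>
        ((abs_sub _ _).trans (add_le_add (uu_bdd hb _) (hcm b hb m hm))).trans hbA
    have hA1 : β ^ 2 + β * E ≤ A := le_add_of_nonneg_right (by positivity)
    have hA2 : β' ^ 2 + β' * E ≤ A := le_add_of_nonneg_left (by positivity)
    have hmm : ∀ (b t : ℝ), 0 ≤ t → ∀ᶠ m : ℕ in atTop,
        Measurable (fun ω => uu b (Zm χ g Φ m t ω) - ∫ x, hfun P g χ b m x ∂μstar) := by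
      intro b t ht
      filter_upwards [eventually_gt_atTop 0] with m hm
      exact ((uu_meas b).comp (S.Zm_meas Q hm ht)).sub_const _
    have hlim := aux_prod_limit (ℙ := ℙ) (hmm β k hk) (hmm β' l hl) (hWm β k) (hWm β' l)
      (A := A) (B := A)
      (by filter_upwards [eventually_gt_atTop 0] with m hm using hmb β k hβ hA1 m hm)
      (by filter_upwards [eventually_gt_atTop 0] with m hm using hmb β' l hβ' hA2 m hm)
      (hWb β k hβ hA1) (hWb β' l hβ' hA2) (L1 β k hβ hk) (L1 β' l hβ' hl)
    refine le_of_tendsto hlim.abs ?_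
    filter_upwards [eventually_gt_atTop 0] with m hm
    have hB : Measurable[natFiltration Φ ((k : ℝ) + 1)]
        (fun ω => uu β (Zm χ g Φ m k ω) - ∫ x, hfun P g χ β m x ∂μstar) :=
      ((uu_meas β).comp (S.Zm_adapted Φ hm hk)).sub_const _
    have hcov := S.cov_m Q hβ' hm (t := (k : ℝ) + 1) (r := (l : ℝ) - (k + 1)) (by positivity)
      (by linarith) hB (hmb β k hβ hA1 m hm) hβ (G := GG Φ x₀ Lx D k)
      (fun ω => dom β _ k ω _ hβ (hcm β hβ m hm) (S.Zm_bd Φ m k ω))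
      (fun ω => by
        unfold GG
        rw [hD, ← hC1def]
        have : 0 ≤ Lx * (dist x₀ (Φ k ω) + dist x₀ (Φ (k + 1) ω)) :=
          mul_nonneg hLx0 (add_nonneg dist_nonneg dist_nonneg)
        linarith) hG.1 hG.2
    rw [add_sub_cancel] at hcov
    refine hcov.trans ?_
    have e : Real.exp (-γ * ((l : ℝ) - (k + 1))) = Real.exp γ * Real.exp (-γ * ((l : ℝ) - k)) := by
      rw [← Real.exp_add]; congr 1; ring
    rw [e]
    have h1 : 0 ≤ C2 * (β * β') * Real.exp (-γ * ((l : ℝ) - k)) := by positivity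
    calc _ = (2 * (2 * Lx + K)) * Real.exp γ * C2 * (β * β') *
          Real.exp (-γ * ((l : ℝ) - k)) := by ring
      _ ≤ _ := by linarith

end

/-! ## An abstract strong law -/

lemma aux_ae_zero {ℙ : Measure Ω} {Y : ℕ → Ω → ℝ} (hm : ∀ j, Measurable (Y j))
    (h0 : ∀ j ω, 0 ≤ Y j ω) (hi : ∀ j, Integrable (Y j) ℙ) {b : ℕ → ℝ} (hb : ∀ j, ∫ ω, Y j ω ∂ℙ ≤ b j)
    (hs : Summable b) : ∀ᵐ ω ∂ℙ, Tendsto (fun j => Y j ω) atTop (𝓝 0) := by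
  have h1 : ∫⁻ ω, ∑' j, ENNReal.ofReal (Y j ω) ∂ℙ ≠ ∞ := by
    rw [lintegral_tsum fun j => (hm j).ennreal_ofReal.aemeasurable]
    have hb0 : ∀ j, 0 ≤ b j := fun j => (integral_nonneg (h0 j)).trans (hb j)
    have hle : ∑' j, ∫⁻ ω, ENNReal.ofReal (Y j ω) ∂ℙ ≤ ∑' j, ENNReal.ofReal (b j) := by
      refine ENNReal.tsum_le_tsum fun j => ?_
      rw [← ofReal_integral_eq_lintegral_ofReal (hi j) (Eventually.of_forall (h0 j))]
      exact ENNReal.ofReal_le_ofReal (hb j)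
    exact ne_top_of_le_ne_top hs.tsum_ofReal_ne_top hle
  have h2 := ae_lt_top (Measurable.tsum fun j => (hm j).ennreal_ofReal) h1
  filter_upwards [h2] with ω hω
  have h3 := ENNReal.tendsto_atTop_zero_of_tsum_ne_top hω.ne
  have h4 := (ENNReal.tendsto_toReal ENNReal.zero_ne_top).comp h3
  simpa [Function.comp_def, ENNReal.toReal_ofReal (h0 _ _)] using h4

lemma aux_geom {ρ : ℝ} (h0 : 0 ≤ ρ) (h1 : ρ < 1) (n : ℕ) :
    ∑ k ∈ Finset.range n, ρ ^ (n - k) ≤ ρ / (1 - ρ) := by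
  have hd : 0 < 1 - ρ := by linarith
  induction n with
  | zero => simp; positivity
  | succ n ih =>
    rw [Finset.sum_range_succ]
    have : ∑ k ∈ Finset.range n, ρ ^ (n + 1 - k) = ρ * ∑ k ∈ Finset.range n, ρ ^ (n - k) := by
      rw [Finset.mul_sum]
      refine Finset.sum_congr rfl fun k hk => ?_
      rw [Nat.succ_sub (Finset.mem_range.1 hk).le, pow_succ']
    rw [this]
    have e : n + 1 - n = 1 := by omega
    rw [e, pow_one]
    calc ρ * ∑ k ∈ Finset.range n, ρ ^ (n - k) + ρ ≤ ρ * (ρ / (1 - ρ)) + ρ := by gcongr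
      _ = _ := by field_simp; ring

lemma aux_var {ℙ : Measure Ω} [IsProbabilityMeasure ℙ] {W : ℕ → Ω → ℝ}
    (hm : ∀ k, Measurable (W k)) {CW : ℕ → ℝ} (hW : ∀ k ω, |W k ω| ≤ CW k)
    {C3 ρ : ℝ} (hC3 : 0 ≤ C3) (h0 : 0 ≤ ρ) (h1 : ρ < 1) {β : ℕ → ℝ} (hβ : ∀ k, 0 ≤ β k)
    (hcov : ∀ k l, k ≤ l → |∫ ω, W k ω * W l ω ∂ℙ| ≤ C3 * (β k * β l) * ρ ^ (l - k))
    {N : ℕ} {B : ℝ} (hB : ∀ k < N, β k ≤ B) :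
    ∀ n ≤ N, ∫ ω, (∑ k ∈ Finset.range n, W k ω) ^ 2 ∂ℙ ≤
      n * (C3 * (B * B) * (1 + 2 * (ρ / (1 - ρ)))) := by
  intro n
  induction n with
  | zero => intro _; simp
  | succ n ih =>
    intro hn
    have ih := ih (by omega)
    have hd : 0 < 1 - ρ := by linarith
    have hij : ∀ k l, Integrable (fun ω => W k ω * W l ω) ℙ := fun k l =>
      aux_bdd_integrable ((hm k).mul (hm l)) (C := CW k * CW l) fun ω => by
        rw [abs_mul]
        exact mul_le_mul (hW k ω) (hW l ω) (abs_nonneg _) ((abs_nonneg _).trans (hW k ω))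
    have hSn : Integrable (fun ω => (∑ k ∈ Finset.range n, W k ω) ^ 2) ℙ := by
      simp_rw [sq, Finset.sum_mul_sum]
      exact integrable_finsetSum _ fun k _ => integrable_finsetSum _ fun l _ => hij k l
    have hcr : Integrable (fun ω => ∑ k ∈ Finset.range n, W k ω * W n ω) ℙ :=
      integrable_finsetSum _ fun k _ => hij k n
    have e : ∀ ω, (∑ k ∈ Finset.range (n + 1), W k ω) ^ 2 =
        ((∑ k ∈ Finset.range n, W k ω) ^ 2 + 2 * ∑ k ∈ Finset.range n, W k ω * W n ω) +
          W n ω * W n ω := fun ω => by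
      rw [Finset.sum_range_succ, ← Finset.sum_mul]; ring
    simp_rw [e]
    have hadd : Integrable (fun ω => (∑ k ∈ Finset.range n, W k ω) ^ 2 +
        2 * ∑ k ∈ Finset.range n, W k ω * W n ω) ℙ := hSn.add (hcr.const_mul 2)
    rw [integral_add hadd (hij n n), integral_add hSn (hcr.const_mul 2),
      integral_const_mul, integral_finsetSum _ fun k _ => hij k n]
    have hB0 : 0 ≤ B := (hβ n).trans (hB n (by omega))
    have t1 : ∀ k ≤ n, ∫ ω, W k ω * W n ω ∂ℙ ≤ C3 * (B * B) * ρ ^ (n - k) := by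
      intro k hk
      refine (le_abs_self _).trans ((hcov k n hk).trans ?_)
      have b1 := hB k (by omega)
      have b2 := hB n (by omega)
      have := hβ n
      gcongr
    have t2 : ∑ k ∈ Finset.range n, ∫ ω, W k ω * W n ω ∂ℙ ≤ C3 * (B * B) * (ρ / (1 - ρ)) := by
      calc _ ≤ ∑ k ∈ Finset.range n, C3 * (B * B) * ρ ^ (n - k) :=
            Finset.sum_le_sum fun k hk => t1 k (Finset.mem_range.1 hk).le
        _ ≤ _ := by
            rw [← Finset.mul_sum]
            exact mul_le_mul_of_nonneg_left (aux_geom h0 h1 n) (by positivity)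
    have t3 := t1 n le_rfl
    rw [Nat.sub_self, pow_zero, mul_one] at t3
    push_cast
    linarith

lemma aux_slln {ℙ : Measure Ω} [IsProbabilityMeasure ℙ] {U : ℕ → Ω → ℝ}
    (hm : ∀ k, Measurable (U k)) (hU0 : ∀ k ω, 0 ≤ U k ω) {CU : ℕ → ℝ} (hU : ∀ k ω, |U k ω| ≤ CU k)
    {c : ℕ → ℝ} {c' : ℝ} (hc : Tendsto c atTop (𝓝 c'))
    {C3 ρ : ℝ} (hC3 : 0 ≤ C3) (h0 : 0 ≤ ρ) (h1 : ρ < 1) {β : ℕ → ℝ} (hβ : ∀ k, 0 ≤ β k)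
    (hcov : ∀ k l, k ≤ l → |∫ ω, (U k ω - c k) * (U l ω - c l) ∂ℙ| ≤
      C3 * (β k * β l) * ρ ^ (l - k))
    {a : ℝ} (ha0 : 0 ≤ a) (ha1 : a < 1) (hβa : ∀ k : ℕ, β k ≤ ((k : ℝ) + 1) ^ (a / 2)) :
    ∀ᵐ ω ∂ℙ, Tendsto (fun n : ℕ => (∑ k ∈ Finset.range n, U k ω) / n) atTop (𝓝 c') := by
  obtain ⟨q, hq⟩ := exists_nat_gt (1 / (1 - a))
  have ha : 0 < 1 - a := by linarith
  have hq1 : 1 < q * (1 - a) := by rwa [div_lt_iff₀ ha] at hq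
  have hq0 : q ≠ 0 := by
    rintro rfl
    simp at hq1
    linarith
  set W : ℕ → Ω → ℝ := fun k ω => U k ω - c k with hWdef
  have hWm : ∀ k, Measurable (W k) := fun k => (hm k).sub_const _
  have hWb : ∀ k ω, |W k ω| ≤ CU k + |c k| := fun k ω =>
    (abs_sub _ _).trans (by gcongr; exact hU k ω)
  set H := C3 * (1 + 2 * (ρ / (1 - ρ))) with hH
  have hd : 0 < 1 - ρ := by linarith
  have hvar : ∀ n : ℕ, ∫ ω, (∑ k ∈ Finset.range n, W k ω) ^ 2 ∂ℙ ≤ H * ((n : ℝ) * (n : ℝ) ^ a) := by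
    intro n
    have := aux_var hWm hWb hC3 h0 h1 hβ hcov (N := n) (B := (n : ℝ) ^ (a / 2)) (fun k hk => by
      refine (hβa k).trans (Real.rpow_le_rpow (by positivity) ?_ (by linarith))
      exact_mod_cast hk) n le_rfl
    refine this.trans_eq ?_
    rw [← Real.rpow_add_of_nonneg (by positivity) (by linarith) (by linarith), add_halves, hH]
    ring
  let nj : ℕ → ℕ := fun j => (j + 1) ^ q
  have hSm : ∀ n, Measurable (fun ω => ∑ k ∈ Finset.range n, W k ω) := fun n =>
    Finset.measurable_fun_sum _ fun k _ => hWm k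
  have hY := aux_ae_zero (ℙ := ℙ)
    (Y := fun j ω => ((∑ k ∈ Finset.range (nj j), W k ω) / (nj j : ℝ)) ^ 2)
    (fun j => ((hSm _).div_const _).pow_const 2) (fun j ω => sq_nonneg _) (fun j => by
      refine aux_bdd_integrable (((hSm _).div_const _).pow_const 2)
        (C := ((∑ k ∈ Finset.range (nj j), (CU k + |c k|)) / (nj j : ℝ)) ^ 2) fun ω => ?_
      rw [abs_pow, abs_div, Nat.abs_cast]
      gcongr
      exact (Finset.abs_sum_le_sum_abs _ _).trans (Finset.sum_le_sum fun k _ => hWb k ω))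
    (b := fun j => H * ((j + 1 : ℕ) : ℝ) ^ (-(q * (1 - a)))) (fun j => by
      simp_rw [div_pow]
      rw [integral_div]
      have hj : (0 : ℝ) < ((j + 1 : ℕ) : ℝ) := by positivity
      have hn : (0 : ℝ) < (nj j : ℝ) := by simp only [nj]; positivity
      rw [div_le_iff₀ (by positivity)]
      refine (hvar _).trans_eq ?_
      have e1 : ((nj j : ℕ) : ℝ) = ((j + 1 : ℕ) : ℝ) ^ (q : ℝ) := by
        simp only [nj]
        rw [Real.rpow_natCast]; push_cast; ring
      rw [e1, ← Real.rpow_mul hj.le, ← Real.rpow_add hj, ← Real.rpow_natCast, ← Real.rpow_mul hj.le,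
        mul_assoc H, ← Real.rpow_add hj]
      congr 2
      push_cast; ring)
    (by
      refine Summable.mul_left _ ?_
      have := (Real.summable_nat_rpow (p := -(q * (1 - a)))).2 (by linarith)
      exact (summable_nat_add_iff 1).2 this)
  have hces := hc.cesaro
  have hnj : Tendsto nj atTop atTop := by
    refine tendsto_atTop_mono (fun j => ?_) tendsto_id
    simp only [id, nj]
    calc j ≤ j + 1 := by omega
      _ = (j + 1) ^ 1 := (pow_one _).symm
      _ ≤ (j + 1) ^ q := Nat.pow_le_pow_right (by omega) (by omega)
  filter_upwards [hY] with ω hω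
  have hsub : Tendsto (fun j => (∑ k ∈ Finset.range (nj j), W k ω) / (nj j : ℝ)) atTop (𝓝 0) := by
    have := hω.sqrt
    simp only [Real.sqrt_sq_eq_abs, Real.sqrt_zero] at this
    exact (tendsto_zero_iff_abs_tendsto_zero _).2 this
  refine tendsto_div_of_monotone_of_exists_subseq_tendsto_div
    (fun n => ∑ k ∈ Finset.range n, U k ω) c' ?_ ?_
  · refine monotone_nat_of_le_succ fun n => ?_
    simp only [Finset.sum_range_succ]
    linarith [hU0 n ω]
  · intro α hα
    refine ⟨nj, ?_, hnj, ?_⟩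
    · have hr : Tendsto (fun j : ℕ => (1 + 1 / ((j : ℝ) + 1)) ^ q) atTop (𝓝 1) := by
        have := (tendsto_one_div_add_atTop_nhds_zero_nat (𝕜 := ℝ)).const_add 1
        simpa using this.pow q
      filter_upwards [hr.eventually (gt_mem_nhds hα)] with j hj
      have hj0 : (0 : ℝ) < (j : ℝ) + 1 := by positivity
      have e : ((nj (j + 1) : ℕ) : ℝ) = (1 + 1 / ((j : ℝ) + 1)) ^ q * ((nj j : ℕ) : ℝ) := by
        simp only [nj]
        push_cast
        rw [← mul_pow]
        congr 1
        field_simp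
      rw [e]
      gcongr
    · have := hsub.add (hces.comp hnj)
      rw [zero_add] at this
      refine this.congr fun j => ?_
      simp only [Function.comp, hWdef, Finset.sum_sub_distrib]
      ring

/-! ## Conclusion -/

lemma aux_incr_eq {P : ℝ → X → Measure X} {g : X → ℝ} {C : ℝ} (hg : Measurable g)
    (hC : ∀ x, |g x| ≤ C) {Φ : ℝ → Ω → X} (hJ : Measurable fun p : ℝ × Ω => Φ p.1 p.2)
    (k : ℕ) (ω : Ω) : incr P g Φ (k + 1) ω = Zc (corrector P g) g Φ k ω := by
  have hm : Measurable (fun s => g (Φ s ω)) :=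
    hg.comp (hJ.comp (measurable_id.prodMk measurable_const))
  have hii : ∀ a b : ℝ, IntervalIntegrable (fun s => g (Φ s ω)) volume a b := fun a b => by
    refine (intervalIntegrable_const (c := C)).mono_fun' hm.aestronglyMeasurable
      (Eventually.of_forall fun s => ?_)
    exact hC _
  have h := intervalIntegral.integral_add_adjacent_intervals (hii 0 k) (hii k (k + 1))
  simp only [incr, mart, addFun, Zc]
  push_cast
  rw [add_sub_cancel_right, ← h]
  ring

/-- truncation levels -/
def lev (p : ℕ∞) (r : ℝ) : ℝ := if p = ⊤ then r else min (√(p.toNat : ℝ)) r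

lemma lev_nonneg (p : ℕ∞) {r : ℝ} (hr : 0 ≤ r) : 0 ≤ lev p r := by
  unfold lev
  split_ifs
  · exact hr
  · exact le_min (Real.sqrt_nonneg _) hr

lemma lev_le (p : ℕ∞) (r : ℝ) : lev p r ≤ r := by
  unfold lev
  split_ifs
  · exact le_rfl
  · exact min_le_right _ _

lemma uu_lev (p : ℕ∞) {r z : ℝ} (hz : |z| ≤ r) : uu (lev p r) z = truncMin (z ^ 2) p := by
  unfold uu lev truncMin
  split_ifs
  · rw [min_eq_left hz, sq_abs]
  · rw [min_left_comm, min_eq_left hz]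
    rcases le_total (√(p.toNat : ℝ)) |z| with h | h
    · rw [min_eq_left h, Real.sq_sqrt (by positivity), min_eq_right]
      rw [← sq_abs]
      exact (Real.sqrt_le_left (abs_nonneg _)).1 h
    · rw [min_eq_right h, sq_abs, min_eq_left]
      rw [← sq_abs]
      exact (Real.le_sqrt (abs_nonneg _) (by positivity)).1 h

lemma aux_rk {a : ℝ} (ha : 0 < a) : Tendsto (fun k : ℕ => ((k : ℝ) + 1) ^ (a / 2)) atTop atTop :=
  (tendsto_rpow_atTop (by linarith)).comp
    (tendsto_atTop_add_const_right _ _ tendsto_natCast_atTop_atTop)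

lemma aux_bc {P : ℝ → X → Measure X} {μ : Measure X} {x₀ : X} {ζ : ℝ} (hA4 : CondA4 P μ x₀ ζ)
    {ℙ : Measure Ω} {Φ : ℝ → Ω → X} (hΦ : IsMarkovProcess P Φ ℙ μ)
    {a κ : ℝ} (ha : 2 / ζ < a) (hκ : 0 < κ) {t : ℕ → ℝ} (ht : ∀ k, 0 ≤ t k) :
    ∀ᵐ ω ∂ℙ, ∀ᶠ k : ℕ in atTop, dist x₀ (Φ (t k) ω) ≤ κ * ((k : ℝ) + 1) ^ (a / 2) := by
  obtain ⟨hζ, M, hM⟩ := hA4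
  have hζ0 : 0 < ζ := by linarith
  have haζ : 1 < a / 2 * ζ := by
    rw [div_lt_iff₀ hζ0] at ha
    linarith
  have key : ∀ k : ℕ, ℙ {ω | κ * ((k : ℝ) + 1) ^ (a / 2) < dist x₀ (Φ (t k) ω)} ≤
      ENNReal.ofReal (max M 0 * κ ^ (-ζ) * ((k + 1 : ℕ) : ℝ) ^ (-(a / 2 * ζ))) := by
    intro k
    have hm := aux_meas_Phi hΦ.jointMeas (t k)
    have hk : (0 : ℝ) < (k : ℝ) + 1 := by positivity
    set r := κ * ((k : ℝ) + 1) ^ (a / 2) with hr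
    have hr0 : 0 < r := by positivity
    have hpos : 0 < r ^ ζ := Real.rpow_pos_of_pos hr0 _
    have hmf : Measurable (fun x : X => ENNReal.ofReal (dist x₀ x ^ ζ)) := by fun_prop
    have hI : ∫⁻ ω, ENNReal.ofReal (dist x₀ (Φ (t k) ω) ^ ζ) ∂ℙ ≤ ENNReal.ofReal (max M 0) := by
      have := hM (t k) (ht k)
      rw [← hΦ.law (t k) (ht k), lintegral_map hmf hm] at this
      exact this.trans (ENNReal.ofReal_le_ofReal (le_max_left _ _))
    calc _ ≤ ℙ {ω | ENNReal.ofReal (r ^ ζ) ≤ ENNReal.ofReal (dist x₀ (Φ (t k) ω) ^ ζ)} := by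
          refine measure_mono fun ω hω => ?_
          exact ENNReal.ofReal_le_ofReal (Real.rpow_le_rpow hr0.le (le_of_lt hω) hζ0.le)
      _ ≤ (∫⁻ ω, ENNReal.ofReal (dist x₀ (Φ (t k) ω) ^ ζ) ∂ℙ) / ENNReal.ofReal (r ^ ζ) :=
          meas_ge_le_lintegral_div (hmf.comp hm).aemeasurable
            (ENNReal.ofReal_pos.2 hpos).ne' ENNReal.ofReal_ne_top
      _ ≤ ENNReal.ofReal (max M 0) / ENNReal.ofReal (r ^ ζ) := by gcongr
      _ = _ := by
          rw [← ENNReal.ofReal_div_of_pos hpos]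
          congr 1
          rw [hr, Real.mul_rpow hκ.le (by positivity), ← Real.rpow_mul hk.le, Real.rpow_neg hκ.le,
            Real.rpow_neg (by positivity)]
          push_cast
          field_simp
  have hsum : ∑' k : ℕ, ℙ {ω | κ * ((k : ℝ) + 1) ^ (a / 2) < dist x₀ (Φ (t k) ω)} ≠ ∞ := by
    refine ne_top_of_le_ne_top ?_ (ENNReal.tsum_le_tsum key)
    refine Summable.tsum_ofReal_ne_top ?_
    refine Summable.mul_left _ ?_
    have := (Real.summable_nat_rpow (p := -(a / 2 * ζ))).2 (by linarith)
    exact (summable_nat_add_iff 1).2 this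
  filter_upwards [ae_eventually_notMem hsum] with ω hω
  filter_upwards [hω] with k hk
  exact not_lt.1 hk

lemma aux_proc {P : ℝ → X → Measure X} {μ : Measure X} {x₀ : X} {M2 : ℝ}
    {ℙ : Measure Ω} [IsProbabilityMeasure ℙ] {Φ : ℝ → Ω → X} (hΦ : IsMarkovProcess P Φ ℙ μ)
    (h : ∀ t, 0 ≤ t → Integrable (fun x => dist x₀ x ^ 2) (measAct P t μ) ∧
      ∫ x, dist x₀ x ^ 2 ∂(measAct P t μ) ≤ M2) : Proc P Φ ℙ μ x₀ M2 := by
  have hmf : Measurable (fun x : X => dist x₀ x ^ 2) := by fun_prop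
  refine ⟨inferInstance, hΦ, fun t ht => ?_, fun t ht => ?_⟩
  · have := (h t ht).1
    rw [← hΦ.law t ht] at this
    exact this.comp_measurable (aux_meas_Phi hΦ.jointMeas t)
  · have := (h t ht).2
    rwa [← hΦ.law t ht, integral_map (aux_meas_Phi hΦ.jointMeas t).aemeasurable
      hmf.aestronglyMeasurable] at this

lemma Setup.final {P : ℝ → X → Measure X} {γ : ℝ} {μ μstar : Measure X} {x₀ : X} {g χ : X → ℝ}
    {K C Lx M2 : ℝ} {Ω' : Type*} [MeasurableSpace Ω'] (S : Setup P γ μstar x₀ g χ K C Lx M2)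
    {Φ : ℝ → Ω → X} {ℙ : Measure Ω} (Q : Proc P Φ ℙ μ x₀ M2)
    {Φ' : ℝ → Ω' → X} {ℙ' : Measure Ω'} (Q' : Proc P Φ' ℙ' μstar x₀ M2)
    {ζ : ℝ} (hA4 : CondA4 P μ x₀ ζ) (p : ℕ∞) :
    ∀ᵐ ω ∂ℙ, Tendsto (fun n : ℕ =>
      (∑ k ∈ Finset.range n, truncMin (Zc χ g Φ k ω ^ 2) p) / n) atTop
        (𝓝 (∫ ω', truncMin (Zc χ g Φ' 0 ω' ^ 2) p ∂ℙ')) := by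
  haveI := Q.prob
  haveI := Q'.prob
  have hζ := hA4.1
  have hγ := S.hA3.2.1
  have h2ζ : 2 / ζ < 1 := by rw [div_lt_one (by linarith)]; exact hζ
  have h2ζ0 : 0 < 2 / ζ := by apply div_pos <;> linarith
  set a := (2 / ζ + 1) / 2 with ha
  have ha0 : 0 < a := by linarith
  have ha1 : a < 1 := by linarith
  have ha2 : 2 / ζ < a := by linarith
  set r : ℕ → ℝ := fun k => ((k : ℝ) + 1) ^ (a / 2) with hr
  have hr0 : ∀ k, 0 ≤ r k := fun k => by positivity
  have hrt : Tendsto r atTop atTop := aux_rk ha0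
  set β : ℕ → ℝ := fun k => lev p (r k) with hβdef
  have hβ0 : ∀ k, 0 ≤ β k := fun k => lev_nonneg p (hr0 k)
  set c : ℕ → ℝ := fun k => ∫ ω', uu (β k) (Zc χ g Φ' 0 ω') ∂ℙ' with hcdef
  -- convergence of the means
  have hc : Tendsto c atTop (𝓝 (∫ ω', truncMin (Zc χ g Φ' 0 ω' ^ 2) p ∂ℙ')) := by
    have hG := S.GG_sq Q' C (t := 0) le_rfl
    refine tendsto_integral_of_dominated_convergence (fun ω' => GG Φ' x₀ Lx C 0 ω' ^ 2)
      (fun k => ((uu_meas _).comp (S.Zc_meas Q')).aestronglyMeasurable) hG.1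
      (fun k => Eventually.of_forall fun ω' => ?_) (Eventually.of_forall fun ω' => ?_)
    · rw [Real.norm_eq_abs, abs_of_nonneg (uu_nonneg _ _)]
      refine (uu_le_sq (hβ0 k) _).trans ?_
      rw [← sq_abs]
      refine pow_le_pow_left₀ (abs_nonneg _) ((S.Zc_bd Φ' 0 ω').trans ?_) 2
      unfold GG
      linarith [dist_nonneg (x := x₀) (y := Φ' (0 + 1) ω')]
    · refine tendsto_const_nhds.congr' ?_
      filter_upwards [hrt.eventually_ge_atTop |Zc χ g Φ' 0 ω'|] with k hk
      exact (uu_lev p hk).symm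
  -- strong law for truncations
  obtain ⟨C3, hC3, hcov⟩ := S.cov Q Q'
  have hslln := aux_slln (ℙ := ℙ) (U := fun k ω => uu (β k) (Zc χ g Φ k ω))
    (fun k => (uu_meas _).comp (S.Zc_meas Q)) (fun k ω => uu_nonneg _ _)
    (CU := fun k => β k ^ 2) (fun k ω => uu_bdd (hβ0 k) _) hc hC3 (ρ := Real.exp (-γ))
    (Real.exp_pos _).le (by rw [Real.exp_lt_one_iff]; linarith) hβ0 (fun k l hkl => by
      have := hcov (β k) (β l) (hβ0 k) (hβ0 l) k l hkl
      have e : Real.exp (-γ * ((l : ℝ) - k)) = Real.exp (-γ) ^ (l - k) := by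
        rw [← Real.exp_nat_mul, Nat.cast_sub hkl, mul_comm]
      rw [e] at this
      exact this) ha0.le ha1 (fun k => lev_le p (r k))
  -- Borel-Cantelli
  have hL := S.hLx0
  have hκ : 0 < 1 / (3 * (Lx + 1)) := by positivity
  have hbc0 := aux_bc hA4 Q.hΦ ha2 hκ (t := fun k => (k : ℝ)) (fun k => by positivity)
  have hbc1 := aux_bc hA4 Q.hΦ ha2 hκ (t := fun k => (k : ℝ) + 1) (fun k => by positivity)
  filter_upwards [hslln, hbc0, hbc1] with ω h1 h2 h3
  have hev : ∀ᶠ k : ℕ in atTop, truncMin (Zc χ g Φ k ω ^ 2) p - uu (β k) (Zc χ g Φ k ω) = 0 := by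
    filter_upwards [h2, h3, hrt.eventually_ge_atTop (3 * C)] with k h2 h3 h4
    rw [sub_eq_zero]
    refine (uu_lev p ((S.Zc_bd Φ k ω).trans ?_)).symm
    have hrk := hr0 k
    change dist x₀ (Φ k ω) ≤ 1 / (3 * (Lx + 1)) * r k at h2
    change dist x₀ (Φ (k + 1) ω) ≤ 1 / (3 * (Lx + 1)) * r k at h3
    have h5 : Lx * (1 / (3 * (Lx + 1))) ≤ 1 / 3 := by
      rw [mul_one_div, div_le_div_iff₀ (by positivity) (by positivity)]
      linarith
    have h6 : Lx * (dist x₀ (Φ k ω) + dist x₀ (Φ (k + 1) ω)) ≤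
        Lx * (1 / (3 * (Lx + 1)) * r k + 1 / (3 * (Lx + 1)) * r k) := by gcongr
    have h7 := mul_le_mul_of_nonneg_right h5 hrk
    nlinarith
  have hd : Tendsto (fun k : ℕ => truncMin (Zc χ g Φ k ω ^ 2) p - uu (β k) (Zc χ g Φ k ω)) atTop
      (𝓝 0) := tendsto_const_nhds.congr' (by filter_upwards [hev] with k hk using hk.symm)
  have := hd.cesaro.add h1
  rw [zero_add] at this
  refine this.congr fun n => ?_
  rw [Finset.sum_sub_distrib]
  ring

/-- Lemma 6. Under (A1)–(A4), for each `p ∈ ℕ ∪ {∞}`,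
`(1/n) Σ_{k=1}^n (Z_k(g)² ∧ p) → E_{μ_*}[Z'_1(g)² ∧ p]` `ℙ_μ`-a.s., where `Z'` is built
from a copy `Φ'` of the process started from the stationary distribution `μ_*`. -/
theorem increments_strong_law
    (P : ℝ → X → Measure X) (hP : IsMarkovSemigroup P)
    (γ ζ : ℝ) (x₀ : X) (μ μstar : Measure X)
    [IsProbabilityMeasure μ] [IsProbabilityMeasure μstar]
    (hA1 : CondA1 P) (hA2 : CondA2 P) (hA3 : CondA3 P γ) (hA4 : CondA4 P μ x₀ ζ)
    (hinv : ∀ t, 0 ≤ t → measAct P t μstar = μstar)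
    (g : X → ℝ) (K : ℝ≥0) (hLip : LipschitzWith K g) (hBd : ∃ C, ∀ x, |g x| ≤ C)
    (hmean : ∫ x, g x ∂μstar = 0)
    (ℙμ : Measure Ω) [IsProbabilityMeasure ℙμ]
    (Φ : ℝ → Ω → X) (hΦ : IsMarkovProcess P Φ ℙμ μ)
    {Ω' : Type*} [MeasurableSpace Ω'] (ℙstar : Measure Ω') [IsProbabilityMeasure ℙstar]
    (Φ' : ℝ → Ω' → X) (hΦ' : IsMarkovProcess P Φ' ℙstar μstar) :
    ∀ p : ℕ∞, ∀ᵐ ω ∂ℙμ,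
      Tendsto (fun n : ℕ =>
          (1 / (n : ℝ)) * ∑ k ∈ Finset.Icc 1 n, truncMin ((incr P g Φ k ω) ^ 2) p)
        atTop (𝓝 (∫ ω', truncMin ((incr P g Φ' 1 ω') ^ 2) p ∂ℙstar)) := by
  intro p
  obtain ⟨C', hC'⟩ := hBd
  have hC : ∀ x, |g x| ≤ max C' 0 := fun x => (hC' x).trans (le_max_left _ _)
  have hK : ∀ x y, |g x - g y| ≤ (K : ℝ) * dist x y := fun x y => by
    have := hLip.dist_le_mul x y
    rwa [Real.dist_eq] at this
  have hγ := hA3.2.1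
  obtain ⟨M2, hM0, hM⟩ := aux_moment_mu hP hA4
  have hstar := aux_moment_star hP hA3 hinv hM0 hM
  have hm : Integrable (fun x => dist x₀ x) μstar := aux_sq_to_one (by fun_prop) hstar.1
  have S : Setup P γ μstar x₀ g (corrector P g) K (max C' 0) (K / γ) M2 :=
    { hP := hP, hA1 := hA1, hA3 := hA3, prob := inferInstance, hinv := hinv, hm := hm
      hK0 := K.2, hK := hK, hC0 := le_max_right _ _, hC := hC
      hLx0 := div_nonneg K.2 hγ.le
      hLx := aux_corrector_lip hP hA3 hinv hm K.2 hK hC hmean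
      hM2 := hM0 }
  have Q : Proc P Φ ℙμ μ x₀ M2 := aux_proc hΦ hM
  have Q' : Proc P Φ' ℙstar μstar x₀ M2 := aux_proc hΦ' fun t ht => by
    rw [hinv t ht]; exact hstar
  have e1 : ∀ k ω, incr P g Φ (k + 1) ω = Zc (corrector P g) g Φ k ω :=
    aux_incr_eq S.gm hC hΦ.jointMeas
  have e2 : ∀ ω', incr P g Φ' 1 ω' = Zc (corrector P g) g Φ' 0 ω' := fun ω' => by
    have := aux_incr_eq (P := P) S.gm hC hΦ'.jointMeas 0 ω'
    simpa using this
  filter_upwards [S.final Q Q' hA4 p] with ω hω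
  simp_rw [e2]
  refine hω.congr fun n => ?_
  rw [one_div, div_eq_inv_mul]
  congr 1
  rw [Finset.range_eq_Ico, Finset.sum_Ico_eq_sum_range, ← Finset.Ico_add_one_right_eq_Icc,
    Finset.sum_Ico_eq_sum_range]
  refine Finset.sum_congr (by simp) fun k _ => ?_
  rw [zero_add, add_comm 1 k, e1]


end
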